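/- Let p ∈ (0,∞). For every symmetric convex body K ⊂ ℝ², M_p([−1,1]²) ≤ M_p(K). -/

import Mathlib

open MeasureTheory Set

/-- The `L^p`-support function of a body `K ⊆ ℝ²`. -/
noncomputable def suppFn (p : ℝ) (K : Set (ℝ × ℝ)) (y : ℝ × ℝ) : ℝ :=
  (1 / p) * Real.log ((∫ x in K, Real.exp (p * (x.1 * y.1 + x.2 * y.2))) / (volume K).toReal)

/-- The `L^p`-Mahler volume of `K ⊆ ℝ²`. -/
noncomputable def mahlerVol (p : ℝ) (K : Set (ℝ × ℝ)) : ℝ :=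
  (volume K).toReal * ∫ y, Real.exp (-(suppFn p K y))

/-- The near norm of the `L^p`-polar body, for `n = 2`. -/
noncomputable def nearNorm (p : ℝ) (K : Set (ℝ × ℝ)) (y : ℝ × ℝ) : ℝ :=
  if y = 0 then 0
  else (∫ r in Set.Ioi (0 : ℝ), r * Real.exp (-(suppFn p K (r • y)))) ^ (-(1 / 2 : ℝ))

/-- The `L^p`-polar body of `K ⊆ ℝ²`. -/
noncomputable def lpPolar (p : ℝ) (K : Set (ℝ × ℝ)) : Set (ℝ × ℝ) :=
  {y | nearNorm p K y ≤ 1}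

namespace LpMahler

open Filter Topology

/-- A continuous positive integrable density has a differentiable increasing distribution function,
which attains exactly the values in `(0, 1)`. -/
lemma exists_distribution {f : ℝ → ℝ} (hf : Continuous f) (hf0 : ∀ x, 0 < f x)
    (hfi : Integrable f) :
    0 < ∫ x, f x ∧ ∃ F : ℝ → ℝ, StrictMono F ∧ (∀ x, HasStrictDerivAt F (f x / ∫ x, f x) x) ∧
      range F = Ioo 0 1 := by
  have hI : 0 < ∫ x, f x := by
    rw [integral_pos_iff_support_of_nonneg (fun x => (hf0 x).le) hfi]
    have : Function.support f = univ := by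
      ext x; simp [(hf0 x).ne']
    simp [this]
  refine ⟨hI, fun x => ((∫ t in Iic (0 : ℝ), f t) + ∫ t in (0 : ℝ)..x, f t) / ∫ x, f x, ?_, ?_, ?_⟩
  · intro x y hxy
    have h1 : ∫ t in (0 : ℝ)..y, f t = (∫ t in (0 : ℝ)..x, f t) + ∫ t in x..y, f t :=
      (intervalIntegral.integral_add_adjacent_intervals (hf.intervalIntegrable _ _)
        (hf.intervalIntegrable _ _)).symm
    have h2 : 0 < ∫ t in x..y, f t :=
      intervalIntegral.intervalIntegral_pos_of_pos (hf.intervalIntegrable _ _) hf0 hxy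
    simp only
    rw [h1]
    gcongr
    linarith
  · intro x
    exact ((hf.integral_hasStrictDerivAt 0 x).const_add _).div_const _
  · have hF : ∀ x, (∫ t in Iic (0 : ℝ), f t) + ∫ t in (0 : ℝ)..x, f t = ∫ t in Iic x, f t := by
      intro x
      rw [← intervalIntegral.integral_Iic_sub_Iic hfi.integrableOn hfi.integrableOn]
      ring
    have hsplit : ∀ x, (∫ t in Iic x, f t) + ∫ t in Ioi x, f t = ∫ t, f t :=
      fun x => intervalIntegral.integral_Iic_add_Ioi hfi.integrableOn hfi.integrableOn
    have hpos : ∀ s : Set ℝ, MeasurableSet s → 0 < volume s → 0 < ∫ t in s, f t := by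
      intro s hs h
      rw [integral_pos_iff_support_of_nonneg (fun x => (hf0 x).le) hfi.integrableOn]
      have : Function.support f = univ := by
        ext x; simp [(hf0 x).ne']
      simpa [this] using h
    have htop : Tendsto (fun x => ((∫ t in Iic (0 : ℝ), f t) + ∫ t in (0 : ℝ)..x, f t) / ∫ x, f x)
        atTop (𝓝 1) := by
      have := ((intervalIntegral_tendsto_integral_Ioi (0 : ℝ) hfi.integrableOn
        tendsto_id).const_add (∫ t in Iic (0 : ℝ), f t)).div_const (∫ x, f x)
      rwa [hsplit, div_self hI.ne'] at this
    have hbot : Tendsto (fun x => ((∫ t in Iic (0 : ℝ), f t) + ∫ t in (0 : ℝ)..x, f t) / ∫ x, f x)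
        atBot (𝓝 0) := by
      have := ((intervalIntegral_tendsto_integral_Iic (0 : ℝ) hfi.integrableOn
        tendsto_id).const_sub (∫ t in Iic (0 : ℝ), f t)).div_const (∫ x, f x)
      rw [sub_self, zero_div] at this
      refine this.congr fun x => ?_
      rw [id, intervalIntegral.integral_symm 0 x, sub_neg_eq_add]
    ext u
    constructor
    · rintro ⟨x, rfl⟩
      simp only [hF]
      refine ⟨div_pos (hpos _ measurableSet_Iic (by simp)) hI, (div_lt_one hI).2 ?_⟩
      rw [← hsplit x]
      linarith [hpos (Ioi x) measurableSet_Ioi (by simp)]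
    · rintro ⟨h0, h1⟩
      obtain ⟨x, hx⟩ := (hbot.eventually (gt_mem_nhds h0)).exists
      obtain ⟨y, hy⟩ := (htop.eventually (lt_mem_nhds h1)).exists
      refine mem_range_of_exists_le_of_exists_ge ?_ ⟨x, hx.le⟩ ⟨y, hy.le⟩
      refine (continuous_const.add ?_).div_const _
      exact intervalIntegral.continuous_primitive (fun a b => hf.intervalIntegrable a b) 0

/-- Monotone transport between two continuous positive integrable densities on the line. -/
lemma exists_transport {f g : ℝ → ℝ} (hf : Continuous f) (hf0 : ∀ x, 0 < f x)
    (hfi : Integrable f) (hg : Continuous g) (hg0 : ∀ x, 0 < g x) (hgi : Integrable g) :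
    ∃ T : ℝ → ℝ, StrictMono T ∧
      ∀ x, HasDerivAt T (f x * (∫ t, g t) / ((∫ t, f t) * g (T x))) x := by
  obtain ⟨hIf, F, hFm, hFd, hFr⟩ := exists_distribution hf hf0 hfi
  obtain ⟨hIg, G, hGm, hGd, hGr⟩ := exists_distribution hg hg0 hgi
  have hex : ∀ x, ∃ z, G z = F x := by
    intro x
    have : F x ∈ range G := by rw [hGr, ← hFr]; exact mem_range_self x
    exact this
  choose T hT using hex
  have hTm : StrictMono T := by
    intro x y hxy
    rw [← hGm.lt_iff_lt, hT, hT]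
    exact hFm hxy
  have hTs : Function.Surjective T := by
    intro z
    have : G z ∈ range F := by rw [hFr, ← hGr]; exact mem_range_self z
    obtain ⟨x, hx⟩ := this
    exact ⟨x, hGm.injective (by rw [hT, hx])⟩
  have hTc : Continuous T := hTm.monotone.continuous_of_surjective hTs
  refine ⟨T, hTm, fun x => ?_⟩
  have hne : g (T x) / ∫ t, g t ≠ 0 := (div_pos (hg0 _) hIg).ne'
  have hloc := (hGd (T x)).to_localInverse hne
  have hleft := (hGd (T x)).eventually_left_inverse hne
  rw [hT] at hloc
  have hcomp := hloc.hasDerivAt.comp x (hFd x).hasDerivAt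
  have hev : T =ᶠ[𝓝 x] ((hGd (T x)).localInverse G _ _ hne) ∘ F := by
    filter_upwards [hTc.continuousAt.eventually hleft] with y hy
    rw [Function.comp_apply, ← hT y, hy]
  have hval : f x * (∫ t, g t) / ((∫ t, f t) * g (T x)) =
      (g (T x) / ∫ t, g t)⁻¹ * (f x / ∫ t, f t) := by
    rw [inv_div, div_mul_div_comm, mul_comm (g (T x)), mul_comm (f x)]
  rw [hval]
  exact hcomp.congr_of_eventuallyEq hev

lemma mul_integral_le_of_subst {f h W W' : ℝ → ℝ} {S : Set ℝ} {C : ℝ} (hS : MeasurableSet S)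
    (hW : ∀ x, HasDerivAt W (W' x) x) (hW' : ∀ x, 0 ≤ W' x) (hWm : StrictMono W)
    (hWS : ∀ x, W x ∈ S) (hh : ∀ x ∈ S, 0 ≤ h x) (hhi : IntegrableOn h S) (hf : Integrable f)
    (hle : ∀ x, C * f x ≤ W' x * h (W x)) :
    C * ∫ x, f x ≤ ∫ x in S, h x := by
  have hsub : W '' univ ⊆ S := by rintro _ ⟨x, -, rfl⟩; exact hWS x
  have hd : ∀ x ∈ univ, HasDerivWithinAt W (W' x) univ x := fun x _ => (hW x).hasDerivWithinAt
  have hInt := (integrableOn_image_iff_integrableOn_abs_deriv_smul MeasurableSet.univ hd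
    hWm.injective.injOn h).1 (hhi.mono_set hsub)
  calc C * ∫ x, f x = ∫ x, C * f x := (integral_const_mul _ _).symm
    _ ≤ ∫ x, |W' x| • h (W x) := by
        refine integral_mono (hf.const_mul C) (by simpa using hInt) fun x => ?_
        simpa [abs_of_nonneg (hW' x)] using hle x
    _ = ∫ x in W '' univ, h x := by
        rw [integral_image_eq_integral_abs_deriv_smul MeasurableSet.univ hd hWm.injective.injOn]
        simp
    _ ≤ ∫ x in S, h x := by
        refine setIntegral_mono_set hhi ?_ hsub.eventuallyLE
        exact (ae_restrict_iff' hS).2 (Eventually.of_forall hh)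

/-- The Prékopa–Leindler inequality on the line, for positive continuous functions. -/
lemma prekopa_leindler {f g h : ℝ → ℝ} (hf : Continuous f) (hf0 : ∀ x, 0 < f x)
    (hfi : Integrable f) (hg : Continuous g) (hg0 : ∀ x, 0 < g x) (hgi : Integrable g)
    (hh : ∀ x, 0 ≤ h x) (hhi : Integrable h) {a b : ℝ} (ha : 0 < a) (hb : 0 < b) (hab : a + b = 1)
    (hle : ∀ x y, f x ^ a * g y ^ b ≤ h (a * x + b * y)) :
    (∫ x, f x) ^ a * (∫ x, g x) ^ b ≤ ∫ x, h x := by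
  obtain ⟨T, hTm, hT⟩ := exists_transport hf hf0 hfi hg hg0 hgi
  have hIf := (exists_distribution hf hf0 hfi).1
  have hIg := (exists_distribution hg hg0 hgi).1
  set I := ∫ x, f x
  set J := ∫ x, g x
  have hT0 : ∀ x, 0 < f x * J / (I * g (T x)) := fun x => by
    have := hf0 x; have := hg0 (T x); positivity
  have key := mul_integral_le_of_subst (f := f) (h := h) (S := univ) (C := (J / I) ^ b)
    (W := fun x => a * x + b * T x) (W' := fun x => a + b * (f x * J / (I * g (T x))))
    MeasurableSet.univ
    (fun x => by simpa using ((hasDerivAt_id x).const_mul a).fun_add ((hT x).const_mul b))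
    (fun x => by have := hT0 x; positivity)
    (fun x y hxy => by
      have := hTm hxy
      simp only
      gcongr)
    (fun _ => mem_univ _) (fun x _ => hh x) hhi.integrableOn hfi
    (fun x => by
      have h1 := Real.geom_mean_le_arith_mean2_weighted ha.le hb.le zero_le_one (hT0 x).le hab
      rw [Real.one_rpow, one_mul, mul_one] at h1
      have h2 := hle x (T x)
      have hfx := hf0 x
      have hgx := hg0 (T x)
      calc (J / I) ^ b * f x
          = (f x * J / (I * g (T x))) ^ b * (f x ^ a * g (T x) ^ b) := by
            have h3 : f x = f x ^ a * f x ^ b := by rw [← Real.rpow_add hfx, hab, Real.rpow_one]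
            rw [Real.div_rpow (by positivity) (by positivity),
              Real.div_rpow (by positivity) (by positivity), Real.mul_rpow hfx.le hIg.le,
              Real.mul_rpow hIf.le hgx.le]
            conv_lhs => rw [h3]
            have h4 : g (T x) ^ b ≠ 0 := (Real.rpow_pos_of_pos hgx b).ne'
            have h5 : I ^ b ≠ 0 := (Real.rpow_pos_of_pos hIf b).ne'
            field_simp
        _ ≤ _ := mul_le_mul h1 h2 (by positivity) ((Real.rpow_nonneg (hT0 x).le b).trans h1))
  rw [Measure.restrict_univ] at key
  refine le_trans (le_of_eq ?_) key
  have h3 : I = I ^ a * I ^ b := by rw [← Real.rpow_add hIf, hab, Real.rpow_one]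
  rw [Real.div_rpow hIg.le hIf.le]
  have h5 : I ^ b ≠ 0 := (Real.rpow_pos_of_pos hIf b).ne'
  have h6 : ∫ x, f x = I := rfl
  rw [h6]
  conv_rhs => enter [2]; rw [h3]
  field_simp

lemma integral_comp_exp_mul_exp (f : ℝ → ℝ) :
    ∫ x, f (Real.exp x) * Real.exp x = ∫ r in Ioi (0 : ℝ), f r := by
  rw [← Real.range_exp, ← image_univ, integral_image_eq_integral_abs_deriv_smul MeasurableSet.univ
    (fun x _ => (Real.hasDerivAt_exp x).hasDerivWithinAt) Real.exp_injective.injOn]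
  simp [mul_comm]

lemma integrable_comp_exp_mul_exp {f : ℝ → ℝ} (hf : IntegrableOn f (Ioi (0 : ℝ))) :
    Integrable fun x => f (Real.exp x) * Real.exp x := by
  rw [← Real.range_exp, ← image_univ, integrableOn_image_iff_integrableOn_abs_deriv_smul
    MeasurableSet.univ (fun x _ => (Real.hasDerivAt_exp x).hasDerivWithinAt)
    Real.exp_injective.injOn] at hf
  simpa [mul_comm] using hf

/-- Ball's inequality for integrals over half-lines, in its quasi-concave form. -/
lemma ball_inequality {f g h : ℝ → ℝ} (hf : Continuous f) (hf0 : ∀ x, 0 < f x)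
    (hfi : IntegrableOn f (Ioi 0)) (hg : Continuous g) (hg0 : ∀ x, 0 < g x)
    (hgi : IntegrableOn g (Ioi 0)) (hh : ∀ x, 0 ≤ h x) (hhi : IntegrableOn h (Ioi 0))
    {c d : ℝ} (hc : 0 < c) (hd : 0 < d) (hcd : c + d = 1)
    (hle : ∀ r s w : ℝ, 0 < r → 0 < s → w = (c / r + d / s)⁻¹ →
      f r ^ (c * w / r) * g s ^ (d * w / s) ≤ h w) :
    min (∫ x in Ioi 0, f x) (∫ x in Ioi 0, g x) ≤ ∫ x in Ioi 0, h x := by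
  have hF := integrable_comp_exp_mul_exp hfi
  have hG := integrable_comp_exp_mul_exp hgi
  have hFc : Continuous fun x => f (Real.exp x) * Real.exp x := by fun_prop
  have hGc : Continuous fun x => g (Real.exp x) * Real.exp x := by fun_prop
  have hF0 : ∀ x, 0 < f (Real.exp x) * Real.exp x := fun x => mul_pos (hf0 _) (Real.exp_pos x)
  have hG0 : ∀ x, 0 < g (Real.exp x) * Real.exp x := fun x => mul_pos (hg0 _) (Real.exp_pos x)
  obtain ⟨T, hTm, hT⟩ := exists_transport hFc hF0 hF hGc hG0 hG
  have hIf := (exists_distribution hFc hF0 hF).1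
  have hIg := (exists_distribution hGc hG0 hG).1
  rw [← integral_comp_exp_mul_exp f, ← integral_comp_exp_mul_exp g]
  set I := ∫ x, f (Real.exp x) * Real.exp x
  set J := ∫ x, g (Real.exp x) * Real.exp x
  have key := mul_integral_le_of_subst (f := fun x => f (Real.exp x) * Real.exp x) (h := h)
    (S := Ioi 0) (C := min I J / I)
    (W := fun x => (c * Real.exp (-x) + d * Real.exp (-T x))⁻¹)
    (W' := fun x => -(c * (Real.exp (-x) * (-1)) + d * (Real.exp (-T x) *
      (-(f (Real.exp x) * Real.exp x * J / (I * (g (Real.exp (T x)) * Real.exp (T x))))))) /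
        (c * Real.exp (-x) + d * Real.exp (-T x)) ^ 2)
    measurableSet_Ioi
    (fun x => by
      refine HasDerivAt.inv (HasDerivAt.add ?_ ?_) (by positivity)
      · exact ((hasDerivAt_neg x).exp).const_mul c
      · exact ((hT x).neg.exp).const_mul d)
    (fun x => by
      have := hF0 x; have := hG0 (T x)
      refine div_nonneg ?_ (sq_nonneg _)
      have h1 : 0 < Real.exp (-x) := Real.exp_pos _
      have h2 : 0 < f (Real.exp x) * Real.exp x * J /
        (I * (g (Real.exp (T x)) * Real.exp (T x))) := by positivity
      have h3 : 0 < Real.exp (-T x) := Real.exp_pos _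
      have h4 := mul_pos hc h1
      have h5 := mul_pos hd (mul_pos h3 h2)
      linarith)
    (fun x y hxy => by
      have h1 := hTm hxy
      simp only
      apply inv_strictAnti₀ (by positivity)
      gcongr)
    (fun x => by simp only [mem_Ioi]; positivity)
    (fun x _ => hh x) hhi hF
    (fun x => by
      set r := Real.exp x with hr
      set s := Real.exp (T x) with hs
      have hr0 : 0 < r := Real.exp_pos x
      have hs0 : 0 < s := Real.exp_pos _
      have hfr := hf0 r
      have hgs := hg0 s
      simp only [Real.exp_neg, ← hr, ← hs]
      have hwr : c * r⁻¹ + d * s⁻¹ = c / r + d / s := by simp only [div_eq_mul_inv]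
      rw [hwr]
      set w := (c / r + d / s)⁻¹ with hw
      have hw0 : 0 < w := by positivity
      set τ := f r * r * J / (I * (g s * s)) with hτ
      have hτ0 : 0 < τ := by positivity
      set a := c * w / r with ha
      set b := d * w / s with hb
      have ha0 : 0 < a := by positivity
      have hb0 : 0 < b := by positivity
      have hab : a + b = 1 := by
        have : a + b = (c / r + d / s) * w := by rw [ha, hb]; ring
        rw [this, hw]
        exact mul_inv_cancel₀ (by positivity)
      have hwab : w = a * r + b * s := by
        rw [ha, hb, div_mul_cancel₀ _ hr0.ne', div_mul_cancel₀ _ hs0.ne', ← add_mul, hcd, one_mul]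
      have hder : -(c * (r⁻¹ * -1) + d * (s⁻¹ * -τ)) / (c / r + d / s) ^ 2
          = w * (a + b * τ) := by
        have : (c / r + d / s) ^ 2 = (w⁻¹) ^ 2 := by rw [hw, inv_inv]
        rw [this, ha, hb]
        field_simp
        ring
      rw [hder]
      have h1 := Real.geom_mean_le_arith_mean2_weighted ha0.le hb0.le zero_le_one hτ0.le hab
      rw [Real.one_rpow, one_mul, mul_one] at h1
      have h2 := hle r s w hr0 hs0 hw
      have h3 := Real.geom_mean_le_arith_mean2_weighted ha0.le hb0.le hr0.le hs0.le hab
      rw [← hwab] at h3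
      have h4 : min I J ≤ I ^ a * J ^ b := by
        have hm : 0 < min I J := lt_min hIf hIg
        calc min I J = min I J ^ a * min I J ^ b := by
              rw [← Real.rpow_add hm, hab, Real.rpow_one]
          _ ≤ I ^ a * J ^ b := by
              gcongr
              · exact min_le_left _ _
              · exact min_le_right _ _
      have e1 : f r = f r ^ a * f r ^ b := by rw [← Real.rpow_add hfr, hab, Real.rpow_one]
      have e2 : I = I ^ a * I ^ b := by rw [← Real.rpow_add hIf, hab, Real.rpow_one]
      have e3 : r = r ^ a * r ^ b := by rw [← Real.rpow_add hr0, hab, Real.rpow_one]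
      have p1 := Real.rpow_pos_of_pos hfr a
      have p2 := Real.rpow_pos_of_pos hfr b
      have p3 := Real.rpow_pos_of_pos hIf a
      have p4 := Real.rpow_pos_of_pos hIf b
      have p5 := Real.rpow_pos_of_pos hgs b
      have p6 := Real.rpow_pos_of_pos hr0 a
      have p7 := Real.rpow_pos_of_pos hr0 b
      have p8 := Real.rpow_pos_of_pos hs0 b
      have p9 := Real.rpow_pos_of_pos hIg b
      calc min I J / I * (f r * r) ≤ I ^ a * J ^ b / I * (f r * r) := by gcongr
        _ = (r ^ a * s ^ b) * τ ^ b * (f r ^ a * g s ^ b) := by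
            rw [hτ, Real.div_rpow (by positivity) (by positivity),
              Real.mul_rpow (by positivity) hIg.le, Real.mul_rpow hfr.le hr0.le,
              Real.mul_rpow hIf.le (by positivity), Real.mul_rpow hgs.le hs0.le]
            conv_lhs => rw [e1]
            conv_lhs => enter [1, 2]; rw [e2]
            conv_lhs => enter [2, 2]; rw [e3]
            field_simp
        _ ≤ w * (a + b * τ) * h w := by gcongr
        )
  rwa [div_mul_cancel₀ _ hIf.ne'] at key

lemma integrable_exp_neg_mul_abs {b : ℝ} (hb : 0 < b) :
    Integrable fun x : ℝ => Real.exp (-(b * |x|)) := by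
  have h1 : IntegrableOn (fun x : ℝ => Real.exp (-(b * |x|))) (Ioi 0) := by
    refine (exp_neg_integrableOn_Ioi 0 hb).congr_fun (fun x hx => ?_) measurableSet_Ioi
    simp [abs_of_pos (mem_Ioi.1 hx)]
  have h2 : IntegrableOn (fun x : ℝ => Real.exp (-(b * |x|))) (Iic 0) := by
    refine (integrableOn_exp_mul_Iic hb 0).congr_fun (fun x hx => ?_) measurableSet_Iic
    simp [abs_of_nonpos (mem_Iic.1 hx)]
  rw [← integrableOn_univ, ← Iic_union_Ioi (a := (0 : ℝ))]
  exact h2.union h1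

section Growth

variable {q : ℝ} {G : ℝ × ℝ → ℝ} {κ c : ℝ}

lemma rpow_neg_le_of_growth (hq : 0 < q) (hκ : 0 < κ)
    (hlow : ∀ x, κ * Real.exp (c * (|x.1| + |x.2|)) ≤ G x) (x : ℝ × ℝ) :
    G x ^ (-q) ≤ κ ^ (-q) * (Real.exp (-(q * c * |x.1|)) * Real.exp (-(q * c * |x.2|))) := by
  calc G x ^ (-q) ≤ (κ * Real.exp (c * (|x.1| + |x.2|))) ^ (-q) :=
        Real.rpow_le_rpow_of_nonpos (by positivity) (hlow x) (by linarith)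
    _ = _ := by
        rw [Real.mul_rpow hκ.le (Real.exp_pos _).le, ← Real.exp_mul, ← Real.exp_add]
        ring_nf

lemma pos_of_growth (hκ : 0 < κ)
    (hlow : ∀ x : ℝ × ℝ, κ * Real.exp (c * (|x.1| + |x.2|)) ≤ G x) (x : ℝ × ℝ) : 0 < G x :=
  lt_of_lt_of_le (by positivity) (hlow x)

lemma continuous_rpow_of_growth (hG : Continuous G) (hκ : 0 < κ)
    (hlow : ∀ x : ℝ × ℝ, κ * Real.exp (c * (|x.1| + |x.2|)) ≤ G x) :
    Continuous fun x => G x ^ (-q) :=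
  hG.rpow_const fun x => Or.inl (pos_of_growth hκ hlow x).ne'

lemma integrable_rpow_of_growth (hq : 0 < q) (hG : Continuous G) (hκ : 0 < κ) (hc : 0 < c)
    (hlow : ∀ x : ℝ × ℝ, κ * Real.exp (c * (|x.1| + |x.2|)) ≤ G x) :
    Integrable fun x => G x ^ (-q) := by
  have h1 := integrable_exp_neg_mul_abs (mul_pos hq hc)
  refine ((h1.mul_prod h1).const_mul (κ ^ (-q))).mono'
    (continuous_rpow_of_growth hG hκ hlow).aestronglyMeasurable (Eventually.of_forall fun x => ?_)
  rw [Real.norm_of_nonneg (Real.rpow_nonneg (pos_of_growth hκ hlow x).le _)]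
  exact rpow_neg_le_of_growth hq hκ hlow x

lemma rpow_section_le_of_growth (hq : 0 < q) (hκ : 0 < κ) (hc : 0 < c)
    (hlow : ∀ x : ℝ × ℝ, κ * Real.exp (c * (|x.1| + |x.2|)) ≤ G x) (s z : ℝ) :
    ‖G (s, z) ^ (-q)‖ ≤ κ ^ (-q) * Real.exp (-(q * c * |z|)) := by
  rw [Real.norm_of_nonneg (Real.rpow_nonneg (pos_of_growth hκ hlow _).le _)]
  refine (rpow_neg_le_of_growth hq hκ hlow (s, z)).trans ?_
  gcongr
  refine mul_le_of_le_one_left (Real.exp_pos _).le (Real.exp_le_one_iff.2 ?_)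
  have : 0 ≤ q * c * |s| := by positivity
  linarith

lemma integrable_section_of_growth (hq : 0 < q) (hG : Continuous G) (hκ : 0 < κ) (hc : 0 < c)
    (hlow : ∀ x : ℝ × ℝ, κ * Real.exp (c * (|x.1| + |x.2|)) ≤ G x) (s : ℝ) :
    Integrable fun z => G (s, z) ^ (-q) := by
  have h1 := integrable_exp_neg_mul_abs (mul_pos hq hc)
  refine (h1.const_mul (κ ^ (-q))).mono' ?_
    (Eventually.of_forall fun z => rpow_section_le_of_growth hq hκ hc hlow s z)
  have := continuous_rpow_of_growth (q := q) hG hκ hlow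
  exact (this.comp (by fun_prop : Continuous fun z : ℝ => (s, z))).aestronglyMeasurable

lemma continuous_marginal_of_growth (hq : 0 < q) (hG : Continuous G) (hκ : 0 < κ) (hc : 0 < c)
    (hlow : ∀ x : ℝ × ℝ, κ * Real.exp (c * (|x.1| + |x.2|)) ≤ G x) :
    Continuous fun s => ∫ z, G (s, z) ^ (-q) := by
  have hcont := continuous_rpow_of_growth (q := q) hG hκ hlow
  have h1 := integrable_exp_neg_mul_abs (mul_pos hq hc)
  refine continuous_of_dominated
    (fun s => (integrable_section_of_growth hq hG hκ hc hlow s).aestronglyMeasurable)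
    (fun s => Eventually.of_forall fun z => rpow_section_le_of_growth hq hκ hc hlow s z)
    (h1.const_mul (κ ^ (-q))) (Eventually.of_forall fun z => ?_)
  exact hcont.comp (by fun_prop : Continuous fun s : ℝ => (s, z))

lemma integral_eq_two_mul_of_even (hq : 0 < q) (hG : Continuous G) (hκ : 0 < κ) (hc : 0 < c)
    (hlow : ∀ x : ℝ × ℝ, κ * Real.exp (c * (|x.1| + |x.2|)) ≤ G x) (hev : ∀ x, G (-x) = G x) :
    ∫ x, G x ^ (-q) = 2 * ∫ s in Ioi (0 : ℝ), ∫ z, G (s, z) ^ (-q) := by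
  have hInt := integrable_rpow_of_growth hq hG hκ hc hlow
  rw [Measure.volume_eq_prod] at hInt ⊢
  rw [integral_prod _ hInt, ← integral_comp_abs]
  congr 1
  ext s
  rcases abs_choice s with h | h
  · rw [h]
  · rw [h, ← integral_neg_eq_self]
    congr 1
    ext z
    rw [← hev (s, -z), Prod.neg_mk, neg_neg]

end Growth

/-- Busemann-type inequality: in a jointly log-convex even family `G t` of functions on the plane,
the integral of `(G t) ^ (-q)` is quasi-concave in `t`. -/
lemma busemann_inequality {q : ℝ} (hq : 0 < q) {G : ℝ → ℝ × ℝ → ℝ} (hG : ∀ t, Continuous (G t))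
    (hev : ∀ t x, G t (-x) = G t x) {κ c : ℝ} (hκ : 0 < κ) (hc : 0 < c)
    (hlow : ∀ t x, κ * Real.exp (c * (|x.1| + |x.2|)) ≤ G t x)
    (hlog : ∀ (t₀ t₁ t : ℝ) (x y : ℝ × ℝ) (a b : ℝ), 0 < a → 0 < b → a + b = 1 →
      t * (a * x.1 + b * y.1) = a * (t₀ * x.1) + b * (t₁ * y.1) →
      G t (a • x + b • y) ≤ G t₀ x ^ a * G t₁ y ^ b)
    {t₀ t₁ : ℝ} (h₀ : t₀ < 0) (h₁ : 0 < t₁) :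
    min (∫ x, G t₀ x ^ (-q)) (∫ x, G t₁ x ^ (-q)) ≤ ∫ x, G 0 x ^ (-q) := by
  have hpos : ∀ t x, 0 < G t x := fun t => pos_of_growth hκ (hlow t)
  have hsec := fun t => integrable_section_of_growth hq (hG t) hκ hc (hlow t)
  have hmc := fun t => continuous_marginal_of_growth hq (hG t) hκ hc (hlow t)
  have hfc : ∀ t s, Continuous fun z => G t (s, z) ^ (-q) := fun t s =>
    (continuous_rpow_of_growth (hG t) hκ (hlow t)).comp
      (by fun_prop : Continuous fun z : ℝ => (s, z))
  have hmp : ∀ t s, 0 < ∫ z, G t (s, z) ^ (-q) := fun t s =>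
    (exists_distribution (hfc t s) (fun z => Real.rpow_pos_of_pos (hpos _ _) _) (hsec t s)).1
  have hmi : ∀ t, IntegrableOn (fun s => ∫ z, G t (s, z) ^ (-q)) (Ioi 0) := fun t => by
    have := integrable_rpow_of_growth hq (hG t) hκ hc (hlow t)
    rw [Measure.volume_eq_prod] at this
    exact this.integral_prod_left.integrableOn
  have heven := fun t => integral_eq_two_mul_of_even hq (hG t) hκ hc (hlow t) (hev t)
  rw [heven, heven, heven, ← mul_min_of_nonneg _ _ zero_le_two]
  have hd : 0 < t₁ - t₀ := by linarith
  have hcd : t₁ / (t₁ - t₀) + -t₀ / (t₁ - t₀) = 1 := by field_simp; ring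
  have hct : t₁ / (t₁ - t₀) * t₀ + -t₀ / (t₁ - t₀) * t₁ = 0 := by field_simp; ring
  have hγ : 0 < t₁ / (t₁ - t₀) := by positivity
  have hδ : 0 < -t₀ / (t₁ - t₀) := div_pos (by linarith) hd
  generalize t₁ / (t₁ - t₀) = γ at *
  generalize -t₀ / (t₁ - t₀) = δ at *
  refine mul_le_mul_of_nonneg_left ?_ zero_le_two
  refine ball_inequality (hmc t₀) (hmp t₀) (hmi t₀) (hmc t₁) (hmp t₁) (hmi t₁)
    (fun s => (hmp 0 s).le) (hmi 0) hγ hδ hcd ?_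
  intro r s w hr hs hw
  have hw0 : 0 < w := by rw [hw]; positivity
  have hab : γ * w / r + δ * w / s = 1 := by
    have : γ * w / r + δ * w / s = (γ / r + δ / s) * w := by ring
    rw [this, hw]
    exact mul_inv_cancel₀ (by positivity)
  have hwr : γ * w / r * r = γ * w := div_mul_cancel₀ _ hr.ne'
  have hws : δ * w / s * s = δ * w := div_mul_cancel₀ _ hs.ne'
  have ha : 0 < γ * w / r := by positivity
  have hb : 0 < δ * w / s := by positivity
  generalize γ * w / r = a at *
  generalize δ * w / s = b at *
  refine prekopa_leindler (hfc t₀ r) (fun z => Real.rpow_pos_of_pos (hpos _ _) _) (hsec t₀ r)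
    (hfc t₁ s) (fun z => Real.rpow_pos_of_pos (hpos _ _) _) (hsec t₁ s)
    (fun z => (Real.rpow_pos_of_pos (hpos _ _) _).le) (hsec 0 w) ha hb hab ?_
  intro y z
  have hpt : a • (r, y) + b • (s, z) = (w, a * y + b * z) := by
    ext
    · simp only [Prod.fst_add, Prod.smul_fst, smul_eq_mul]
      rw [hwr, hws, ← add_mul, hcd, one_mul]
    · simp
  have h := hlog t₀ t₁ 0 (r, y) (s, z) a b ha hb hab (by
    simp only
    linear_combination (-w) * hct - t₀ * hwr - t₁ * hws)
  rw [hpt] at h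
  have h' := Real.rpow_le_rpow_of_nonpos (hpos _ _) h (by linarith : -q ≤ 0)
  rw [Real.mul_rpow (Real.rpow_nonneg (hpos _ _).le _) (Real.rpow_nonneg (hpos _ _).le _),
    ← Real.rpow_mul (hpos _ _).le, ← Real.rpow_mul (hpos _ _).le] at h'
  rwa [← Real.rpow_mul (hpos _ _).le, ← Real.rpow_mul (hpos _ _).le, mul_comm (-q) a,
    mul_comm (-q) b]

/-- The standard triangle with vertices `0`, `(1, 0)`, `(0, 1)`. -/
def stdTriangle : Set (ℝ × ℝ) := {x | 0 ≤ x.1 ∧ 0 ≤ x.2 ∧ x.1 + x.2 ≤ 1}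

/-- The integral over the standard triangle of the exponential of the affine function with values
`α`, `β`, `γ` at the vertices. -/
noncomputable def triExp (α β γ : ℝ) : ℝ :=
  ∫ x in stdTriangle, Real.exp (α + x.1 * (β - α) + x.2 * (γ - α))

/-- The symmetrized exponential integral over a triangle with one vertex at the origin. -/
noncomputable def coneExp (α β : ℝ) : ℝ := triExp 0 α β + triExp 0 (-α) (-β)

lemma isClosed_stdTriangle : IsClosed stdTriangle := by
  refine (isClosed_le continuous_const continuous_fst).inter
    ((isClosed_le continuous_const continuous_snd).inter
      (isClosed_le (continuous_fst.add continuous_snd) continuous_const))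

lemma measurableSet_stdTriangle : MeasurableSet stdTriangle := isClosed_stdTriangle.measurableSet

lemma isCompact_stdTriangle : IsCompact stdTriangle := by
  refine (isCompact_Icc (a := ((0 : ℝ), (0 : ℝ))) (b := (1, 1))).of_isClosed_subset
    isClosed_stdTriangle fun x hx => ?_
  obtain ⟨h1, h2, h3⟩ := hx
  exact ⟨⟨h1, h2⟩, ⟨by linarith, by linarith⟩⟩

lemma integrableOn_stdTriangle {f : ℝ × ℝ → ℝ} (hf : Continuous f) :
    IntegrableOn f stdTriangle := hf.continuousOn.integrableOn_compact isCompact_stdTriangle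

lemma box_subset_stdTriangle {a b c d : ℝ} (ha : 0 ≤ a) (hc : 0 ≤ c) (hbd : b + d ≤ 1) :
    Icc a b ×ˢ Icc c d ⊆ stdTriangle := by
  rintro x ⟨⟨h1, h2⟩, ⟨h3, h4⟩⟩
  exact ⟨ha.trans h1, hc.trans h3, by linarith⟩

lemma mul_le_integral_stdTriangle {f : ℝ × ℝ → ℝ} (hf : Continuous f) (hf0 : ∀ x, 0 ≤ f x)
    {a b c d m : ℝ} (ha : 0 ≤ a) (hc : 0 ≤ c) (hbd : b + d ≤ 1) (hab : a ≤ b) (hcd : c ≤ d)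
    (hm : ∀ x ∈ Icc a b ×ˢ Icc c d, m ≤ f x) :
    (b - a) * (d - c) * m ≤ ∫ x in stdTriangle, f x := by
  have hsub := box_subset_stdTriangle ha hc hbd
  have hvol : (volume (Icc a b ×ˢ Icc c d)).toReal = (b - a) * (d - c) := by
    rw [Measure.volume_eq_prod, Measure.prod_prod, Real.volume_Icc, Real.volume_Icc,
      ENNReal.toReal_mul, ENNReal.toReal_ofReal (by linarith), ENNReal.toReal_ofReal (by linarith)]
  have hmeas : MeasurableSet (Icc a b ×ˢ Icc c d) := measurableSet_Icc.prod measurableSet_Icc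
  have hInt := integrableOn_stdTriangle hf
  have hfin : volume (Icc a b ×ˢ Icc c d) ≠ ⊤ :=
    (isCompact_Icc.prod isCompact_Icc).measure_lt_top.ne
  calc (b - a) * (d - c) * m = ∫ _ in Icc a b ×ˢ Icc c d, m := by
        rw [setIntegral_const, smul_eq_mul, Measure.real, hvol]
    _ ≤ ∫ x in Icc a b ×ˢ Icc c d, f x :=
        setIntegral_mono_on (integrableOn_const hfin) (hInt.mono_set hsub) hmeas hm
    _ ≤ _ := setIntegral_mono_set hInt (Eventually.of_forall hf0) hsub.eventuallyLE

lemma continuous_affineExp (α β γ : ℝ) :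
    Continuous fun x : ℝ × ℝ => Real.exp (α + x.1 * (β - α) + x.2 * (γ - α)) := by fun_prop

lemma triExp_pos (α β γ : ℝ) : 0 < triExp α β γ := by
  have h : IntegrableOn (fun x : ℝ × ℝ => Real.exp (α + x.1 * (β - α) + x.2 * (γ - α)))
    stdTriangle := integrableOn_stdTriangle (continuous_affineExp α β γ)
  rw [triExp, setIntegral_pos_iff_support_of_nonneg_ae
    (Eventually.of_forall fun x => (Real.exp_pos _).le) h]
  have h1 : Function.support (fun x : ℝ × ℝ => Real.exp (α + x.1 * (β - α) + x.2 * (γ - α)))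
      = univ := by
    ext x; simp [(Real.exp_pos _).ne']
  rw [h1, univ_inter]
  refine lt_of_lt_of_le ?_ (measure_mono (box_subset_stdTriangle (a := 0) (b := 1 / 2) (c := 0)
    (d := 1 / 2) le_rfl le_rfl (by norm_num)))
  rw [Measure.volume_eq_prod, Measure.prod_prod, Real.volume_Icc]
  simp

lemma continuous_triExp : Continuous fun p : ℝ × ℝ × ℝ => triExp p.1 p.2.1 p.2.2 := by
  refine continuous_parametric_integral_of_continuous ?_ isCompact_stdTriangle
  fun_prop

lemma triExp_geom_le {a b : ℝ} (ha : 0 < a) (hb : 0 < b) (hab : a + b = 1)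
    (α β γ α' β' γ' : ℝ) :
    triExp (a * α + b * α') (a * β + b * β') (a * γ + b * γ')
      ≤ triExp α β γ ^ a * triExp α' β' γ' ^ b := by
  set A := triExp α β γ with hA
  set B := triExp α' β' γ' with hB
  have hA0 : 0 < A := triExp_pos _ _ _
  have hB0 : 0 < B := triExp_pos _ _ _
  have hi := integrableOn_stdTriangle (continuous_affineExp α β γ)
  have hi' := integrableOn_stdTriangle (continuous_affineExp α' β' γ')
  have hle : ∀ x : ℝ × ℝ,
      Real.exp (a * α + b * α' + x.1 * (a * β + b * β' - (a * α + b * α')) +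
        x.2 * (a * γ + b * γ' - (a * α + b * α'))) ≤
      A ^ a * B ^ b * (a / A * Real.exp (α + x.1 * (β - α) + x.2 * (γ - α)) +
        b / B * Real.exp (α' + x.1 * (β' - α') + x.2 * (γ' - α'))) := by
    intro x
    set u := α + x.1 * (β - α) + x.2 * (γ - α) with hu
    set v := α' + x.1 * (β' - α') + x.2 * (γ' - α') with hv
    have h1 := Real.geom_mean_le_arith_mean2_weighted ha.le hb.le
      (div_pos (Real.exp_pos u) hA0).le (div_pos (Real.exp_pos v) hB0).le hab
    have h2 : a * α + b * α' + x.1 * (a * β + b * β' - (a * α + b * α')) +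
        x.2 * (a * γ + b * γ' - (a * α + b * α')) = u * a + v * b := by
      rw [hu, hv]; ring
    rw [h2, Real.exp_add, Real.exp_mul, Real.exp_mul]
    rw [Real.div_rpow (Real.exp_pos u).le hA0.le, Real.div_rpow (Real.exp_pos v).le hB0.le] at h1
    have hAa := Real.rpow_pos_of_pos hA0 a
    have hBb := Real.rpow_pos_of_pos hB0 b
    calc Real.exp u ^ a * Real.exp v ^ b
        = A ^ a * B ^ b * (Real.exp u ^ a / A ^ a * (Real.exp v ^ b / B ^ b)) := by field_simp
      _ ≤ A ^ a * B ^ b * (a * (Real.exp u / A) + b * (Real.exp v / B)) := by gcongr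
      _ = _ := by ring
  calc triExp (a * α + b * α') (a * β + b * β') (a * γ + b * γ')
      ≤ ∫ x in stdTriangle, A ^ a * B ^ b *
        (a / A * Real.exp (α + x.1 * (β - α) + x.2 * (γ - α)) +
        b / B * Real.exp (α' + x.1 * (β' - α') + x.2 * (γ' - α'))) := by
        refine setIntegral_mono (integrableOn_stdTriangle (continuous_affineExp _ _ _)) ?_ hle
        exact ((hi.const_mul _).add (hi'.const_mul _)).const_mul _
    _ = A ^ a * B ^ b * (a / A * A + b / B * B) := by
        rw [integral_const_mul, integral_add (hi.const_mul _) (hi'.const_mul _),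
          integral_const_mul, integral_const_mul]
        rfl
    _ = A ^ a * B ^ b := by
        rw [div_mul_cancel₀ _ hA0.ne', div_mul_cancel₀ _ hB0.ne', hab, mul_one]

lemma integral_stdTriangle {f : ℝ × ℝ → ℝ} (hf : Continuous f) :
    ∫ x in stdTriangle, f x = ∫ s in (0 : ℝ)..1, ∫ u in (0 : ℝ)..(1 - s), f (s, u) := by
  have hInt := (integrableOn_stdTriangle hf).integrable_indicator measurableSet_stdTriangle
  rw [← integral_indicator measurableSet_stdTriangle, Measure.volume_eq_prod] at *
  rw [integral_prod _ hInt, intervalIntegral.integral_of_le zero_le_one,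
    ← integral_Icc_eq_integral_Ioc, ← integral_indicator measurableSet_Icc]
  congr 1
  ext s
  by_cases hs : s ∈ Icc (0 : ℝ) 1
  · rw [indicator_of_mem hs, intervalIntegral.integral_of_le (by linarith [hs.2]),
      ← integral_Icc_eq_integral_Ioc, ← integral_indicator measurableSet_Icc]
    congr 1
    ext u
    have : ((s, u) ∈ stdTriangle) ↔ u ∈ Icc 0 (1 - s) := by
      simp only [stdTriangle, mem_ofPred_eq, mem_Icc]
      constructor
      · rintro ⟨_, h2, h3⟩; exact ⟨h2, by linarith⟩
      · rintro ⟨h2, h3⟩; exact ⟨hs.1, h2, by linarith⟩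
    by_cases hu : u ∈ Icc 0 (1 - s)
    · rw [indicator_of_mem hu, indicator_of_mem (this.2 hu)]
    · rw [indicator_of_notMem hu, indicator_of_notMem (fun h => hu (this.1 h))]
  · rw [indicator_of_notMem hs]
    have : ∀ u, stdTriangle.indicator f (s, u) = 0 := fun u => by
      refine indicator_of_notMem (fun h => hs ?_) _
      obtain ⟨h1, h2, h3⟩ := h
      exact ⟨h1, by simp only at h2 h3; linarith⟩
    simp [this]

lemma triExp_zero_eq {α β : ℝ} (hα : α ≠ 0) (hβ : β ≠ 0) (hαβ : α ≠ β) :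
    triExp 0 α β = ((Real.exp β - 1) / β - (Real.exp α - 1) / α) / (β - α) := by
  have hβα : β - α ≠ 0 := sub_ne_zero.2 hαβ.symm
  rw [triExp, integral_stdTriangle (by fun_prop)]
  have h1 : ∀ s : ℝ, ∫ u in (0 : ℝ)..(1 - s), Real.exp (0 + s * (α - 0) + u * (β - 0))
      = (Real.exp (β + s * (α - β)) - Real.exp (s * α)) / β := by
    intro s
    have hd : ∀ u ∈ uIcc 0 (1 - s), HasDerivAt (fun u => Real.exp (0 + s * (α - 0) + u * (β - 0)) / β)
        (Real.exp (0 + s * (α - 0) + u * (β - 0))) u := by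
      intro u _
      have := ((((hasDerivAt_id u).mul_const (β - 0)).const_add (0 + s * (α - 0))).exp).div_const β
      simpa [hβ] using this
    rw [intervalIntegral.integral_eq_sub_of_hasDerivAt hd
      (Continuous.intervalIntegrable (by fun_prop) _ _), ← sub_div]
    ring_nf
  simp only [h1]
  have hd : ∀ s ∈ uIcc (0 : ℝ) 1, HasDerivAt
      (fun s => (Real.exp (β + s * (α - β)) / (α - β) - Real.exp (s * α) / α) / β)
      ((Real.exp (β + s * (α - β)) - Real.exp (s * α)) / β) s := by
    intro s _
    have hαβ' : α - β ≠ 0 := sub_ne_zero.2 hαβ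
    have e1 := ((((hasDerivAt_id s).mul_const (α - β)).const_add β).exp).div_const (α - β)
    have e2 := (((hasDerivAt_id s).mul_const α).exp).div_const α
    have := (e1.sub e2).div_const β
    simpa [hα, hαβ'] using this
  rw [intervalIntegral.integral_eq_sub_of_hasDerivAt hd
    (Continuous.intervalIntegrable (by fun_prop) _ _)]
  have hαβ' : α - β ≠ 0 := sub_ne_zero.2 hαβ
  have : β - α = -(α - β) := by ring
  rw [this]
  simp only [one_mul, zero_mul, add_zero, Real.exp_zero, add_sub_cancel]
  field_simp
  ring

lemma triExp_eq_exp_mul (α β γ : ℝ) :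
    triExp α β γ = Real.exp α * triExp 0 (β - α) (γ - α) := by
  rw [triExp, triExp, ← integral_const_mul]
  congr 1
  ext x
  rw [← Real.exp_add]
  ring_nf

/-- The exponential integral over a quadrilateral, cut along either of two triangulations. -/
lemma triExp_quadrilateral {p q r α β γ : ℝ} (hα : α ≠ 0) (hβ : β ≠ 0) (hγ : γ ≠ 0) (hαβ : α ≠ β)
    (hβγ : β ≠ γ) (hαγ : α ≠ γ) (h : p * γ + q * α = r * β) :
    p * triExp 0 α β + q * triExp 0 β γ = r * triExp 0 α γ + (p + q - r) * triExp α β γ := by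
  rw [triExp_eq_exp_mul α, triExp_zero_eq hα hβ hαβ, triExp_zero_eq hβ hγ hβγ,
    triExp_zero_eq hα hγ hαγ, triExp_zero_eq (sub_ne_zero.2 hαβ.symm) (sub_ne_zero.2 hαγ.symm)
      (fun h => hβγ (sub_left_injective h))]
  have e1 : Real.exp α * Real.exp (γ - α) = Real.exp γ := by rw [← Real.exp_add]; ring_nf
  have e2 : Real.exp α * Real.exp (β - α) = Real.exp β := by rw [← Real.exp_add]; ring_nf
  have e3 : Real.exp α * (((Real.exp (γ - α) - 1) / (γ - α) - (Real.exp (β - α) - 1) / (β - α)) /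
      (γ - α - (β - α))) = ((Real.exp γ - Real.exp α) / (γ - α) -
      (Real.exp β - Real.exp α) / (β - α)) / (γ - β) := by
    rw [← e1, ← e2]
    rw [show γ - α - (β - α) = γ - β by ring]
    ring
  have : (p + q - r) * (Real.exp α * (((Real.exp (γ - α) - 1) / (γ - α) -
      (Real.exp (β - α) - 1) / (β - α)) / (γ - α - (β - α)))) =
      (p + q - r) * (((Real.exp γ - Real.exp α) / (γ - α) -
      (Real.exp β - Real.exp α) / (β - α)) / (γ - β)) := by rw [e3]
  rw [this]
  have h1 : β - α ≠ 0 := sub_ne_zero.2 hαβ.symm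
  have h2 : γ - β ≠ 0 := sub_ne_zero.2 hβγ.symm
  have h3 : γ - α ≠ 0 := sub_ne_zero.2 hαγ.symm
  have hr : r = (p * γ + q * α) / β := by field_simp; linarith
  rw [hr]
  field_simp
  ring

lemma coneExp_growth (α β : ℝ) :
    1 / 32 * Real.exp (3 / 16 * (|α| + |β|)) ≤ coneExp α β := by
  have hc1 := continuous_affineExp 0 α β
  have hc2 := continuous_affineExp 0 (-α) (-β)
  have hsum : coneExp α β = ∫ x in stdTriangle, (Real.exp (0 + x.1 * (α - 0) + x.2 * (β - 0)) +
      Real.exp (0 + x.1 * (-α - 0) + x.2 * (-β - 0))) := by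
    rw [integral_add (integrableOn_stdTriangle hc1) (integrableOn_stdTriangle hc2)]
    rfl
  have hf0 : ∀ x : ℝ × ℝ, 0 ≤ Real.exp (0 + x.1 * (α - 0) + x.2 * (β - 0)) +
      Real.exp (0 + x.1 * (-α - 0) + x.2 * (-β - 0)) := fun x => by positivity
  have hpt : ∀ (x : ℝ × ℝ) (C : ℝ), C ≤ |x.1 * α + x.2 * β| → Real.exp C ≤
      Real.exp (0 + x.1 * (α - 0) + x.2 * (β - 0)) +
      Real.exp (0 + x.1 * (-α - 0) + x.2 * (-β - 0)) := by
    intro x C hC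
    have e1 : 0 + x.1 * (α - 0) + x.2 * (β - 0) = x.1 * α + x.2 * β := by ring
    have e2 : 0 + x.1 * (-α - 0) + x.2 * (-β - 0) = -(x.1 * α + x.2 * β) := by ring
    rw [e1, e2]
    refine (Real.exp_le_exp.2 hC).trans ?_
    have p1 := (Real.exp_pos (x.1 * α + x.2 * β)).le
    have p2 := (Real.exp_pos (-(x.1 * α + x.2 * β))).le
    rcases abs_choice (x.1 * α + x.2 * β) with h | h <;> rw [h] <;> linarith
  have habs : ∀ s u α β : ℝ, 1 / 2 ≤ s → 0 ≤ u → u ≤ 1 / 8 → |β| ≤ |α| →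
      3 / 16 * (|α| + |β|) ≤ |s * α + u * β| := by
    intro s u α β hs hu hu' h
    have h1 : |s * α| - |u * β| ≤ |s * α + u * β| := by
      have := abs_sub_abs_le_abs_sub (s * α) (-(u * β))
      rwa [abs_neg, sub_neg_eq_add] at this
    rw [abs_mul, abs_mul, abs_of_nonneg (by linarith : 0 ≤ s), abs_of_nonneg hu] at h1
    have h2 : 1 / 2 * |α| ≤ s * |α| := by gcongr
    have h3 : u * |β| ≤ 1 / 8 * |β| := by gcongr
    linarith
  rw [hsum]
  rcases le_total |β| |α| with h | h
  · have := mul_le_integral_stdTriangle (hc1.add hc2) hf0 (a := 1 / 2) (b := 3 / 4) (c := 0)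
      (d := 1 / 8) (m := Real.exp (3 / 16 * (|α| + |β|))) (by norm_num) le_rfl (by norm_num)
      (by norm_num) (by norm_num) fun x hx => hpt x _ (habs _ _ _ _ hx.1.1 hx.2.1 hx.2.2 h)
    refine le_trans (le_of_eq ?_) this
    norm_num
  · have := mul_le_integral_stdTriangle (hc1.add hc2) hf0 (a := 0) (b := 1 / 8) (c := 1 / 2)
      (d := 3 / 4) (m := Real.exp (3 / 16 * (|α| + |β|))) le_rfl (by norm_num) (by norm_num)
      (by norm_num) (by norm_num) fun x hx => hpt x _ (by
        have := habs _ _ _ _ hx.2.1 hx.1.1 hx.1.2 h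
        rwa [add_comm |β|, add_comm (x.2 * β)] at this)
    refine le_trans (le_of_eq ?_) this
    norm_num

/-- The standard inner product on the plane. -/
def dot (x y : ℝ × ℝ) : ℝ := x.1 * y.1 + x.2 * y.2

/-- The determinant of two vectors of the plane. -/
def cross (x y : ℝ × ℝ) : ℝ := x.1 * y.2 - x.2 * y.1

/-- The symmetrized exponential integral over the triangle `0, u, v` and its reflection. -/
noncomputable def coneTerm (u v y : ℝ × ℝ) : ℝ := cross u v * coneExp (dot u y) (dot v y)

lemma integral_comp_dot {u v : ℝ × ℝ} (h : cross u v ≠ 0) (f : ℝ × ℝ → ℝ) :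
    ∫ y, f (dot u y, dot v y) = |cross u v|⁻¹ * ∫ x, f x := by
  set L := Matrix.toLin (Module.Basis.finTwoProd ℝ) (Module.Basis.finTwoProd ℝ)
    !![u.1, u.2; v.1, v.2] with hL
  have hdet : LinearMap.det L = cross u v := by
    rw [hL, LinearMap.det_toLin, Matrix.det_fin_two_of, cross]
  have happ : ∀ y, L y = (dot u y, dot v y) := fun y => by
    rw [hL, Matrix.toLin_finTwoProd_apply]; rfl
  have hmap := Measure.map_linearMap_addHaar_eq_smul_addHaar volume (f := L) (by rwa [hdet])
  rw [hdet] at hmap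
  let e := (LinearEquiv.ofIsUnitDet (f := L) (v := Module.Basis.finTwoProd ℝ)
    (v' := Module.Basis.finTwoProd ℝ) (by
      rw [← LinearMap.det_toMatrix (Module.Basis.finTwoProd ℝ)] at hdet
      rw [hdet]; exact h.isUnit)).toContinuousLinearEquiv.toHomeomorph.toMeasurableEquiv
  have := integral_map_equiv (μ := volume) e f
  rw [show (⇑e : ℝ × ℝ → ℝ × ℝ) = L from rfl, hmap, integral_smul_measure,
    ENNReal.toReal_ofReal (abs_nonneg _), abs_inv, smul_eq_mul] at this
  rw [this]
  exact integral_congr_ae (ae_of_all _ fun y => congrArg f (happ y).symm)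

lemma ae_dot_ne_zero {u : ℝ × ℝ} (hu : u ≠ 0) : ∀ᵐ y : ℝ × ℝ, dot u y ≠ 0 := by
  let ℓ : ℝ × ℝ →ₗ[ℝ] ℝ := u.1 • LinearMap.fst ℝ ℝ ℝ + u.2 • LinearMap.snd ℝ ℝ ℝ
  have hℓ : ∀ y, ℓ y = dot u y := fun y => by simp [ℓ, dot]
  have hne : LinearMap.ker ℓ ≠ ⊤ := by
    intro h
    have h1 : ℓ u = 0 := by
      have : u ∈ LinearMap.ker ℓ := by rw [h]; trivial
      exact this
    rw [hℓ, dot] at h1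
    apply hu
    have h2 : u.1 = 0 := by nlinarith [mul_self_nonneg u.1, mul_self_nonneg u.2]
    have h3 : u.2 = 0 := by nlinarith [mul_self_nonneg u.1, mul_self_nonneg u.2]
    exact Prod.ext h2 h3
  have := Measure.addHaar_submodule volume _ hne
  rw [ae_iff]
  convert this using 2
  ext y
  simp [hℓ]

lemma coneTerm_neg_neg (u v y : ℝ × ℝ) : coneTerm (-u) (-v) y = coneTerm u v y := by
  simp only [coneTerm, cross, coneExp, dot, Prod.fst_neg, Prod.snd_neg]
  ring_nf

/-- The quadrilateral identity for the exponential integrals of triangles with a vertex at the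
origin. -/
lemma ae_coneTerm_add_coneTerm {u v w : ℝ × ℝ} (hu : u ≠ 0) (hv : v ≠ 0) (hw : w ≠ 0)
    (huv : u ≠ v) (hvw : v ≠ w) (huw : u ≠ w) :
    ∀ᵐ y : ℝ × ℝ, coneTerm u v y + coneTerm v w y = coneTerm u w y +
      (cross u v + cross v w - cross u w) * (triExp (dot u y) (dot v y) (dot w y) +
        triExp (-dot u y) (-dot v y) (-dot w y)) := by
  have hsub : ∀ a b y : ℝ × ℝ, dot (a - b) y = dot a y - dot b y := fun a b y => by
    simp only [dot, Prod.fst_sub, Prod.snd_sub]; ring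
  filter_upwards [ae_dot_ne_zero hu, ae_dot_ne_zero hv, ae_dot_ne_zero hw,
    ae_dot_ne_zero (sub_ne_zero.2 huv), ae_dot_ne_zero (sub_ne_zero.2 hvw),
    ae_dot_ne_zero (sub_ne_zero.2 huw)] with y h1 h2 h3 h4 h5 h6
  rw [hsub, sub_ne_zero] at h4 h5 h6
  have hrel : cross u v * dot w y + cross v w * dot u y = cross u w * dot v y := by
    simp only [cross, dot]; ring
  have e1 := triExp_quadrilateral h1 h2 h3 h4 h5 h6 hrel
  have e2 := triExp_quadrilateral (neg_ne_zero.2 h1) (neg_ne_zero.2 h2) (neg_ne_zero.2 h3)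
    (fun h => h4 (neg_injective h)) (fun h => h5 (neg_injective h))
    (fun h => h6 (neg_injective h)) (p := cross u v) (q := cross v w) (r := cross u w)
    (by linarith)
  simp only [coneTerm, coneExp]
  linarith

lemma add_geom_le {a b : ℝ} (ha : 0 < a) (hb : 0 < b) (hab : a + b = 1) {x₁ x₂ y₁ y₂ : ℝ}
    (hx₁ : 0 ≤ x₁) (hx₂ : 0 ≤ x₂) (hy₁ : 0 ≤ y₁) (hy₂ : 0 ≤ y₂) :
    x₁ ^ a * x₂ ^ b + y₁ ^ a * y₂ ^ b ≤ (x₁ + y₁) ^ a * (x₂ + y₂) ^ b := by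
  rcases (add_nonneg hx₁ hy₁).eq_or_lt with h | h
  · have h1 : x₁ = 0 := by linarith
    have h2 : y₁ = 0 := by linarith
    simp [h1, h2, Real.zero_rpow ha.ne']
  rcases (add_nonneg hx₂ hy₂).eq_or_lt with h' | h'
  · have h1 : x₂ = 0 := by linarith
    have h2 : y₂ = 0 := by linarith
    simp [h1, h2, Real.zero_rpow hb.ne']
  have e1 := Real.geom_mean_le_arith_mean2_weighted ha.le hb.le (div_nonneg hx₁ h.le)
    (div_nonneg hx₂ h'.le) hab
  have e2 := Real.geom_mean_le_arith_mean2_weighted ha.le hb.le (div_nonneg hy₁ h.le)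
    (div_nonneg hy₂ h'.le) hab
  rw [Real.div_rpow hx₁ h.le, Real.div_rpow hx₂ h'.le] at e1
  rw [Real.div_rpow hy₁ h.le, Real.div_rpow hy₂ h'.le] at e2
  have p1 := Real.rpow_pos_of_pos h a
  have p2 := Real.rpow_pos_of_pos h' b
  have e3 : a * (x₁ / (x₁ + y₁)) + b * (x₂ / (x₂ + y₂)) + (a * (y₁ / (x₁ + y₁)) +
      b * (y₂ / (x₂ + y₂))) = 1 := by
    field_simp
    linear_combination ((x₁ + y₁) * (x₂ + y₂)) * hab
  calc x₁ ^ a * x₂ ^ b + y₁ ^ a * y₂ ^ b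
      = (x₁ + y₁) ^ a * (x₂ + y₂) ^ b * (x₁ ^ a / (x₁ + y₁) ^ a * (x₂ ^ b / (x₂ + y₂) ^ b) +
        y₁ ^ a / (x₁ + y₁) ^ a * (y₂ ^ b / (x₂ + y₂) ^ b)) := by field_simp
    _ ≤ (x₁ + y₁) ^ a * (x₂ + y₂) ^ b * 1 := by
        gcongr
        linarith
    _ = _ := mul_one _

lemma mul_geom_eq {a b : ℝ} (hab : a + b = 1) {k x y : ℝ} (hk : 0 ≤ k)
    (hx : 0 ≤ x) (hy : 0 ≤ y) : (k * x) ^ a * (k * y) ^ b = k * (x ^ a * y ^ b) := by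
  rw [Real.mul_rpow hk hx, Real.mul_rpow hk hy]
  have : k ^ a * k ^ b = k := by
    rw [← Real.rpow_add' hk (by rw [hab]; norm_num), hab, Real.rpow_one]
  linear_combination (x ^ a * y ^ b) * this

/-- Continuous, even, nonnegative, log-convex functions on the plane. -/
structure EvenLogConvex (R : ℝ × ℝ → ℝ) : Prop where
  continuous : Continuous R
  even : ∀ y, R (-y) = R y
  nonneg : ∀ y, 0 ≤ R y
  geom_le : ∀ (x y : ℝ × ℝ) (a b : ℝ), 0 < a → 0 < b → a + b = 1 →
    R (a • x + b • y) ≤ R x ^ a * R y ^ b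

lemma EvenLogConvex.zero : EvenLogConvex fun _ => 0 where
  continuous := continuous_const
  even _ := rfl
  nonneg _ := le_rfl
  geom_le _ _ _ _ _ _ _ := by positivity

lemma EvenLogConvex.add {R S : ℝ × ℝ → ℝ} (hR : EvenLogConvex R) (hS : EvenLogConvex S) :
    EvenLogConvex fun y => R y + S y where
  continuous := hR.continuous.add hS.continuous
  even y := by rw [hR.even, hS.even]
  nonneg y := add_nonneg (hR.nonneg y) (hS.nonneg y)
  geom_le x y a b ha hb hab := (add_le_add (hR.geom_le x y a b ha hb hab)
    (hS.geom_le x y a b ha hb hab)).trans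
      (add_geom_le ha hb hab (hR.nonneg x) (hR.nonneg y) (hS.nonneg x) (hS.nonneg y))

lemma EvenLogConvex.sum {ι : Type*} (s : Finset ι) {R : ι → ℝ × ℝ → ℝ}
    (hR : ∀ i ∈ s, EvenLogConvex (R i)) : EvenLogConvex fun y => ∑ i ∈ s, R i y := by
  classical
  induction s using Finset.induction_on with
  | empty => simpa using EvenLogConvex.zero
  | insert i s hi ih =>
    simp only [Finset.sum_insert hi]
    exact (hR i (Finset.mem_insert_self i s)).add
      (ih fun j hj => hR j (Finset.mem_insert_of_mem hj))

lemma dot_smul_add (u x y : ℝ × ℝ) (a b : ℝ) :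
    dot u (a • x + b • y) = a * dot u x + b * dot u y := by
  simp only [dot, Prod.fst_add, Prod.snd_add, Prod.smul_fst, Prod.smul_snd, smul_eq_mul]; ring

lemma dot_neg (u y : ℝ × ℝ) : dot u (-y) = -dot u y := by
  simp only [dot, Prod.fst_neg, Prod.snd_neg]; ring

lemma continuous_dot (u : ℝ × ℝ) : Continuous (dot u) := by
  unfold dot; fun_prop

lemma triExp_add_triExp_neg_geom_le {a b : ℝ} (ha : 0 < a) (hb : 0 < b) (hab : a + b = 1)
    (α β γ α' β' γ' : ℝ) :
    triExp (a * α + b * α') (a * β + b * β') (a * γ + b * γ') +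
      triExp (-(a * α + b * α')) (-(a * β + b * β')) (-(a * γ + b * γ')) ≤
    (triExp α β γ + triExp (-α) (-β) (-γ)) ^ a *
      (triExp α' β' γ' + triExp (-α') (-β') (-γ')) ^ b := by
  refine le_trans (add_le_add (triExp_geom_le ha hb hab α β γ α' β' γ') ?_)
    (add_geom_le ha hb hab (triExp_pos _ _ _).le (triExp_pos _ _ _).le (triExp_pos _ _ _).le
      (triExp_pos _ _ _).le)
  have := triExp_geom_le ha hb hab (-α) (-β) (-γ) (-α') (-β') (-γ')
  refine le_trans (le_of_eq ?_) this
  congr 1 <;> ring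

lemma evenLogConvex_coneTerm {u v : ℝ × ℝ} (h : 0 ≤ cross u v) :
    EvenLogConvex (coneTerm u v) where
  continuous := by
    refine continuous_const.mul ((continuous_triExp.comp
      (g := fun p : ℝ × ℝ × ℝ => triExp p.1 p.2.1 p.2.2)
      (f := fun y => ((0 : ℝ), dot u y, dot v y)) ?_).add
      (continuous_triExp.comp (g := fun p : ℝ × ℝ × ℝ => triExp p.1 p.2.1 p.2.2)
      (f := fun y => ((0 : ℝ), -dot u y, -dot v y)) ?_))
    · have := continuous_dot u; have := continuous_dot v; fun_prop
    · have := continuous_dot u; have := continuous_dot v; fun_prop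
  even y := by
    simp only [coneTerm, coneExp, dot_neg, neg_neg]
    rw [add_comm (triExp 0 (-dot u y) _)]
  nonneg y := mul_nonneg h (add_pos (triExp_pos _ _ _) (triExp_pos _ _ _)).le
  geom_le x y a b ha hb hab := by
    simp only [coneTerm, coneExp]
    rw [mul_geom_eq hab h (add_pos (triExp_pos _ _ _) (triExp_pos _ _ _)).le
      (add_pos (triExp_pos _ _ _) (triExp_pos _ _ _)).le, dot_smul_add, dot_smul_add]
    refine mul_le_mul_of_nonneg_left ?_ h
    have := triExp_add_triExp_neg_geom_le ha hb hab 0 (dot u x) (dot v x) 0 (dot u y) (dot v y)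
    simpa using this

lemma abs_growth (s z : ℝ) : |s| + |z| ≤ 2 * (|z| + |z + s|) := by
  have h1 : |s| ≤ |z + s| + |z| := by
    have := abs_sub (z + s) z
    rwa [add_sub_cancel_left] at this
  have h2 := abs_nonneg (z + s)
  have h3 := abs_nonneg z
  linarith

lemma dot_sub_left (a b y : ℝ × ℝ) : dot (a - b) y = dot a y - dot b y := by
  simp only [dot, Prod.fst_sub, Prod.snd_sub]; ring

/-- The functional is quasi-concave when a vertex moves parallel to the chord of its neighbours. -/
lemma integral_rpow_move {q : ℝ} (hq : 0 < q) {R : ℝ × ℝ → ℝ} (hR : EvenLogConvex R)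
    {u v w : ℝ × ℝ} (huw : 0 < cross u w) {k : ℝ} (hk : 0 ≤ k) {t₀ t₁ : ℝ} (h₀ : t₀ < 0)
    (h₁ : 0 < t₁) (G : ℝ → ℝ × ℝ → ℝ)
    (hG : ∀ t y, G t y = R y + coneTerm u w y +
      k * (triExp (dot u y) (dot v y + t * dot (w - u) y) (dot w y) +
        triExp (-dot u y) (-(dot v y + t * dot (w - u) y)) (-dot w y))) :
    min (∫ y, G t₀ y ^ (-q)) (∫ y, G t₁ y ^ (-q)) ≤ ∫ y, G 0 y ^ (-q) := by
  set D := cross u w with hD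
  let Y : ℝ × ℝ → ℝ × ℝ := fun x =>
    ((x.2 * w.2 - (x.2 + x.1) * u.2) / D, ((x.2 + x.1) * u.1 - x.2 * w.1) / D)
  have hYu : ∀ x, dot u (Y x) = x.2 := fun x => by
    have : D ≠ 0 := huw.ne'
    simp only [dot, Y]
    field_simp
    rw [hD, cross]; ring
  have hYw : ∀ x, dot w (Y x) = x.2 + x.1 := fun x => by
    have : D ≠ 0 := huw.ne'
    simp only [dot, Y]
    field_simp
    rw [hD, cross]; ring
  have hYs : ∀ x, dot (w - u) (Y x) = x.1 := fun x => by
    rw [dot_sub_left, hYu, hYw]; ring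
  have hYinv : ∀ y, Y (dot (w - u) y, dot u y) = y := fun y => by
    have : D ≠ 0 := huw.ne'
    simp only [Y, dot_sub_left]
    ext
    · simp only; field_simp; rw [hD, cross]; simp only [dot]; ring
    · simp only; field_simp; rw [hD, cross]; simp only [dot]; ring
  have hYc : Continuous Y := by
    simp only [Y]; fun_prop
  have hYlin : ∀ (x y : ℝ × ℝ) (a b : ℝ), Y (a • x + b • y) = a • Y x + b • Y y := by
    intro x y a b
    simp only [Y]
    ext <;> simp only [Prod.fst_add, Prod.snd_add, Prod.smul_fst, Prod.smul_snd, smul_eq_mul] <;>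
      ring
  have hYneg : ∀ x, Y (-x) = -Y x := by
    intro x
    simp only [Y]
    ext <;> simp only [Prod.fst_neg, Prod.snd_neg] <;> ring
  have hcr : cross (w - u) u ≠ 0 := by
    have : cross (w - u) u = -D := by
      rw [hD]; simp only [cross, Prod.fst_sub, Prod.snd_sub]; ring
    rw [this]; exact neg_ne_zero.2 huw.ne'
  have hInt : ∀ t, ∫ y, G t y ^ (-q) = |cross (w - u) u|⁻¹ * ∫ x, G t (Y x) ^ (-q) := by
    intro t
    rw [← integral_comp_dot hcr (fun x => G t (Y x) ^ (-q))]
    simp only [hYinv]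
  have hS := hR.add (evenLogConvex_coneTerm huw.le)
  have hGpos : ∀ t y, 0 ≤ triExp (dot u y) (dot v y + t * dot (w - u) y) (dot w y) +
        triExp (-dot u y) (-(dot v y + t * dot (w - u) y)) (-dot w y) := fun t y =>
    (add_pos (triExp_pos _ _ _) (triExp_pos _ _ _)).le
  have hGc : ∀ t, Continuous (G t) := by
    intro t
    have c1 := continuous_dot u
    have c2 := continuous_dot v
    have c3 := continuous_dot w
    have c4 := continuous_dot (w - u)
    rw [funext (hG t)]
    refine hS.continuous.add (continuous_const.mul ((continuous_triExp.comp
      (g := fun p : ℝ × ℝ × ℝ => triExp p.1 p.2.1 p.2.2)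
      (f := fun y => (dot u y, dot v y + t * dot (w - u) y, dot w y)) ?_).add
      (continuous_triExp.comp (g := fun p : ℝ × ℝ × ℝ => triExp p.1 p.2.1 p.2.2)
      (f := fun y => (-dot u y, -(dot v y + t * dot (w - u) y), -dot w y)) ?_)))
    · fun_prop
    · fun_prop
  rw [hInt, hInt, hInt, ← mul_min_of_nonneg _ _ (by positivity)]
  refine mul_le_mul_of_nonneg_left ?_ (by positivity)
  refine busemann_inequality hq (G := fun t x => G t (Y x)) (fun t => (hGc t).comp hYc) ?_
    (κ := D * (1 / 32)) (c := 3 / 32) (by positivity) (by norm_num) ?_ ?_ h₀ h₁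
  · intro t x
    simp only [hYneg, hG, hS.even, dot_neg]
    rw [mul_neg, ← neg_add, neg_neg, neg_neg, neg_neg, add_comm (triExp (-dot u (Y x)) _ _)]
  · intro t x
    simp only [hG]
    have h1 := hR.nonneg (Y x)
    have h2 := mul_nonneg hk (hGpos t (Y x))
    have h3 : D * (1 / 32) * Real.exp (3 / 32 * (|x.1| + |x.2|)) ≤ coneTerm u w (Y x) := by
      rw [coneTerm, hYu, hYw, mul_assoc]
      refine mul_le_mul_of_nonneg_left (le_trans ?_ (coneExp_growth _ _)) huw.le
      gcongr ?_ * Real.exp ?_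
      have := abs_growth x.1 x.2
      linarith
    linarith
  · intro s₀ s₁ s x y a b ha hb hab hs
    simp only [hG, hYlin]
    have h1 := hS.geom_le (Y x) (Y y) a b ha hb hab
    have h2 := triExp_add_triExp_neg_geom_le ha hb hab (dot u (Y x))
      (dot v (Y x) + s₀ * dot (w - u) (Y x)) (dot w (Y x)) (dot u (Y y))
      (dot v (Y y) + s₁ * dot (w - u) (Y y)) (dot w (Y y))
    have h3 := mul_le_mul_of_nonneg_left h2 hk
    rw [← mul_geom_eq hab hk (hGpos _ _) (hGpos _ _)] at h3
    refine le_trans (add_le_add h1 ?_) (add_geom_le ha hb hab (hS.nonneg _) (hS.nonneg _)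
      (mul_nonneg hk (hGpos _ _)) (mul_nonneg hk (hGpos _ _)))
    refine le_trans (le_of_eq ?_) h3
    have e : a * dot v (Y x) + b * dot v (Y y) + s * dot (w - u) (a • Y x + b • Y y) =
        a * (dot v (Y x) + s₀ * dot (w - u) (Y x)) + b * (dot v (Y y) + s₁ * dot (w - u) (Y y)) := by
      rw [dot_smul_add, hYs, hYs]
      linarith
    rw [dot_smul_add u, dot_smul_add v, dot_smul_add w, e]

/-- Moving a strictly convex vertex `v` parallel to the chord of its neighbours `u`, `w`. -/
lemma integral_rpow_vertex_move {q : ℝ} (hq : 0 < q) {R : ℝ × ℝ → ℝ} (hR : EvenLogConvex R)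
    {u v w : ℝ × ℝ} (huw : 0 < cross u w) (hk : 0 < cross u v + cross v w - cross u w)
    {t₀ t₁ : ℝ} (h₀ : t₀ < 0) (h₁ : 0 < t₁) (hv : v ≠ 0) (hv₀ : v + t₀ • (w - u) ≠ 0)
    (hv₁ : v + t₁ • (w - u) ≠ 0) :
    min (∫ y, (R y + (coneTerm u (v + t₀ • (w - u)) y + coneTerm (v + t₀ • (w - u)) w y)) ^ (-q))
      (∫ y, (R y + (coneTerm u (v + t₁ • (w - u)) y + coneTerm (v + t₁ • (w - u)) w y)) ^ (-q))
    ≤ ∫ y, (R y + (coneTerm u v y + coneTerm v w y)) ^ (-q) := by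
  have hu0 : u ≠ 0 := by rintro rfl; simp [cross] at huw
  have hw0 : w ≠ 0 := by rintro rfl; simp [cross] at huw
  have huw' : u ≠ w := by rintro rfl; simp [cross, mul_comm] at huw
  have hkt : ∀ t : ℝ, cross u (v + t • (w - u)) + cross (v + t • (w - u)) w - cross u w =
      cross u v + cross v w - cross u w := by
    intro t
    simp only [cross, Prod.fst_add, Prod.snd_add, Prod.smul_fst, Prod.smul_snd, smul_eq_mul,
      Prod.fst_sub, Prod.snd_sub]
    ring
  have hut : ∀ t : ℝ, u ≠ v + t • (w - u) := by
    intro t h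
    have := hkt t
    rw [← h] at this
    have h' : cross u u = 0 := by simp [cross, mul_comm]
    linarith
  have hwt : ∀ t : ℝ, v + t • (w - u) ≠ w := by
    intro t h
    have := hkt t
    rw [h] at this
    have h' : cross w w = 0 := by simp [cross, mul_comm]
    linarith
  have key := integral_rpow_move hq hR (v := v) huw hk.le h₀ h₁ _ (fun _ _ => rfl)
  have hae : ∀ t : ℝ, v + t • (w - u) ≠ 0 →
      ∫ y, (R y + (coneTerm u (v + t • (w - u)) y + coneTerm (v + t • (w - u)) w y)) ^ (-q) =
      ∫ y, (R y + coneTerm u w y + (cross u v + cross v w - cross u w) *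
        (triExp (dot u y) (dot v y + t * dot (w - u) y) (dot w y) +
        triExp (-dot u y) (-(dot v y + t * dot (w - u) y)) (-dot w y))) ^ (-q) := by
    intro t ht
    refine integral_congr_ae ?_
    filter_upwards [ae_coneTerm_add_coneTerm hu0 ht hw0 (hut t) (hwt t) huw'] with y hy
    rw [hy, hkt]
    have : dot (v + t • (w - u)) y = dot v y + t * dot (w - u) y := by
      simp only [dot, Prod.fst_add, Prod.snd_add, Prod.smul_fst, Prod.smul_snd, smul_eq_mul]; ring
    rw [this, add_assoc]
  have h0 := hae 0 (by simpa using hv)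
  rw [zero_smul, add_zero] at h0
  rw [hae t₀ hv₀, hae t₁ hv₁, h0]
  exact key

/-- The value of the functional at parallelograms. -/
noncomputable def parallelogramValue (q : ℝ) : ℝ :=
  2 ^ (1 + q) * ∫ x : ℝ × ℝ, (coneExp x.1 x.2 + coneExp x.2 (-x.1)) ^ (-q)

lemma parallelogram_eq (q : ℝ) {u v : ℝ × ℝ} (h : 0 < cross u v) :
    (2 * cross u v) ^ (1 + q) * ∫ y, (coneTerm u v y + coneTerm v (-u) y) ^ (-q) =
      parallelogramValue q := by
  have h1 : ∀ y, (coneTerm u v y + coneTerm v (-u) y) ^ (-q) = cross u v ^ (-q) *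
      (coneExp (dot u y) (dot v y) + coneExp (dot v y) (-dot u y)) ^ (-q) := by
    intro y
    have e1 : cross v (-u) = cross u v := by
      simp only [cross, Prod.fst_neg, Prod.snd_neg]; ring
    have e2 : dot (-u) y = -dot u y := by
      simp only [dot, Prod.fst_neg, Prod.snd_neg]; ring
    rw [coneTerm, coneTerm, e1, e2, ← mul_add, Real.mul_rpow h.le]
    have p : ∀ α β, 0 ≤ coneExp α β := fun α β => (add_pos (triExp_pos _ _ _) (triExp_pos _ _ _)).le
    exact add_nonneg (p _ _) (p _ _)
  simp only [h1]
  rw [integral_const_mul, integral_comp_dot h.ne'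
    (fun x => (coneExp x.1 x.2 + coneExp x.2 (-x.1)) ^ (-q)), parallelogramValue,
    Real.mul_rpow zero_le_two h.le, abs_of_pos h, Real.rpow_add h, Real.rpow_one, Real.rpow_neg h.le]
  have := (Real.rpow_pos_of_pos h q).ne'
  field_simp

/-- Twice the signed area of the triangle `u, v, w`. -/
def turn (u v w : ℝ × ℝ) : ℝ := cross u v + cross v w - cross u w

/-- In the convex chain `v₀, v₁, v₂, v₃, v₄` the inner vertices can be replaced by `X, Y`. -/
structure Reduction (v₀ v₁ v₂ v₃ v₄ X Y : ℝ × ℝ) : Prop where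
  left_cone : ∃ a b : ℝ, 0 ≤ a ∧ 0 ≤ b ∧ 0 < a + b ∧ X = a • v₁ + b • v₂
  right_cone : ∃ a b : ℝ, 0 ≤ a ∧ 0 ≤ b ∧ 0 < a + b ∧ Y = a • v₂ + b • v₃
  cross_pos : 0 < cross X Y
  left_turn : 0 ≤ turn v₀ X Y
  right_turn : 0 ≤ turn X Y v₄
  left_ray : ∃ k : ℝ, 0 < k ∧ X = v₀ + k • (v₁ - v₀)
  right_ray : ∃ k : ℝ, 0 < k ∧ Y = v₄ + k • (v₃ - v₄)

lemma cross_swap_swap (u v : ℝ × ℝ) : cross u.swap v.swap = cross v u := by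
  simp only [cross, Prod.fst_swap, Prod.snd_swap]; ring

lemma turn_swap_swap (u v w : ℝ × ℝ) : turn u.swap v.swap w.swap = turn w v u := by
  simp only [turn, cross_swap_swap]; ring

lemma swap_add_smul (u v : ℝ × ℝ) (a b : ℝ) : (a • u + b • v).swap = a • u.swap + b • v.swap := rfl

lemma Reduction.swap {v₀ v₁ v₂ v₃ v₄ X Y : ℝ × ℝ}
    (h : Reduction v₄.swap v₃.swap v₂.swap v₁.swap v₀.swap Y.swap X.swap) :
    Reduction v₀ v₁ v₂ v₃ v₄ X Y where
  left_cone := by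
    obtain ⟨a, b, ha, hb, hab, e⟩ := h.right_cone
    refine ⟨b, a, hb, ha, by linarith, ?_⟩
    rw [← swap_add_smul] at e
    rw [Prod.swap_injective e, add_comm]
  right_cone := by
    obtain ⟨a, b, ha, hb, hab, e⟩ := h.left_cone
    refine ⟨b, a, hb, ha, by linarith, ?_⟩
    rw [← swap_add_smul] at e
    rw [Prod.swap_injective e, add_comm]
  cross_pos := by simpa only [cross_swap_swap] using h.cross_pos
  left_turn := by simpa only [turn_swap_swap] using h.right_turn
  right_turn := by simpa only [turn_swap_swap] using h.left_turn
  left_ray := by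
    obtain ⟨k, hk, e⟩ := h.right_ray
    exact ⟨k, hk, Prod.swap_injective e⟩
  right_ray := by
    obtain ⟨k, hk, e⟩ := h.left_ray
    exact ⟨k, hk, Prod.swap_injective e⟩

lemma eq_cross_combination {u v : ℝ × ℝ} (h : cross u v ≠ 0) (x : ℝ × ℝ) :
    x = (cross x v / cross u v) • u + (cross u x / cross u v) • v := by
  ext
  · simp only [Prod.fst_add, Prod.smul_fst, smul_eq_mul]
    field_simp
    simp only [cross]; ring
  · simp only [Prod.snd_add, Prod.smul_snd, smul_eq_mul]
    field_simp
    simp only [cross]; ring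

section chain

variable {v₀ v₁ v₂ v₃ v₄ : ℝ × ℝ}

lemma cross_mul_turn_right : cross v₂ v₃ * turn v₁ v₃ v₄ =
    cross v₁ v₃ * turn v₂ v₃ v₄ + cross v₃ v₄ * turn v₁ v₂ v₃ := by
  simp only [turn, cross]; ring

lemma cross_mul_turn_left : cross v₁ v₂ * turn v₀ v₁ v₃ =
    cross v₁ v₃ * turn v₀ v₁ v₂ + cross v₀ v₁ * turn v₁ v₂ v₃ := by
  simp only [turn, cross]; ring

lemma reduction_middle (h₀₁ : 0 < cross v₀ v₁) (h₁₂ : 0 < cross v₁ v₂) (h₂₃ : 0 < cross v₂ v₃)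
    (h₃₄ : 0 < cross v₃ v₄) (h₁₃ : 0 < cross v₁ v₃) (k₁ : 0 ≤ turn v₀ v₁ v₂)
    (k₂ : 0 ≤ turn v₁ v₂ v₃) (k₃ : 0 ≤ turn v₂ v₃ v₄) : Reduction v₀ v₁ v₂ v₃ v₄ v₁ v₃ where
  left_cone := ⟨1, 0, by simp⟩
  right_cone := ⟨0, 1, by simp⟩
  cross_pos := h₁₃
  left_turn := by
    refine nonneg_of_mul_nonneg_right (b := turn v₀ v₁ v₃) ?_ h₁₂
    rw [cross_mul_turn_left]; positivity
  right_turn := by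
    refine nonneg_of_mul_nonneg_right (b := turn v₁ v₃ v₄) ?_ h₂₃
    rw [cross_mul_turn_right]; positivity
  left_ray := ⟨1, by simp⟩
  right_ray := ⟨1, by simp⟩

lemma reduction_right (h₀₁ : 0 < cross v₀ v₁) (h₁₂ : 0 < cross v₁ v₂) (h₂₃ : 0 < cross v₂ v₃)
    (h₃₄ : 0 < cross v₃ v₄) (h₁₃ : 0 < cross v₁ v₃) (k₁ : 0 ≤ turn v₀ v₁ v₂)
    (k₂ : 0 < turn v₁ v₂ v₃) (k₃ : 0 ≤ turn v₂ v₃ v₄) :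
    ∃ t : ℝ, (t = 0 ∨ 0 < t) ∧ (t = 0 → turn v₂ v₃ v₄ = 0) ∧
      Reduction v₀ v₁ v₂ v₃ v₄ v₁ (v₂ + t • (v₃ - v₁)) ∧
      turn (v₂ + t • (v₃ - v₁)) v₃ v₄ = 0 ∧ 0 < cross (v₂ + t • (v₃ - v₁)) v₄ := by
  have hE : 0 < turn v₁ v₃ v₄ := by
    refine pos_of_mul_pos_right (b := turn v₁ v₃ v₄) ?_ h₂₃.le
    rw [cross_mul_turn_right]; positivity
  have hL : 0 ≤ turn v₀ v₁ v₃ := by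
    refine nonneg_of_mul_nonneg_right (b := turn v₀ v₁ v₃) ?_ h₁₂
    rw [cross_mul_turn_left]; positivity
  set t := turn v₂ v₃ v₄ / turn v₁ v₃ v₄ with ht
  set s := turn v₁ v₂ v₃ / turn v₁ v₃ v₄ with hs
  have ht0 : 0 ≤ t := by positivity
  have hs0 : 0 < s := by positivity
  have hY : v₂ + t • (v₃ - v₁) = v₃ + s • (v₃ - v₄) := by
    have e1 : t * turn v₁ v₃ v₄ = turn v₂ v₃ v₄ := div_mul_cancel₀ _ hE.ne'
    have e2 : s * turn v₁ v₃ v₄ = turn v₁ v₂ v₃ := div_mul_cancel₀ _ hE.ne'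
    ext
    · simp only [Prod.fst_add, Prod.smul_fst, Prod.fst_sub, smul_eq_mul]
      apply mul_right_cancel₀ hE.ne'
      have i : turn v₁ v₃ v₄ * (v₂.1 - v₃.1) + turn v₂ v₃ v₄ * (v₃.1 - v₁.1) -
        turn v₁ v₂ v₃ * (v₃.1 - v₄.1) = 0 := by simp only [turn, cross]; ring
      linear_combination i + (v₃.1 - v₁.1) * e1 - (v₃.1 - v₄.1) * e2
    · simp only [Prod.snd_add, Prod.smul_snd, Prod.snd_sub, smul_eq_mul]
      apply mul_right_cancel₀ hE.ne'
      have i : turn v₁ v₃ v₄ * (v₂.2 - v₃.2) + turn v₂ v₃ v₄ * (v₃.2 - v₁.2) -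
        turn v₁ v₂ v₃ * (v₃.2 - v₄.2) = 0 := by simp only [turn, cross]; ring
      linear_combination i + (v₃.2 - v₁.2) * e1 - (v₃.2 - v₄.2) * e2
  set Y := v₂ + t • (v₃ - v₁) with hYdef
  have c1 : cross v₁ Y = cross v₁ v₂ + t * cross v₁ v₃ := by
    rw [hYdef]; simp only [cross, Prod.fst_add, Prod.snd_add, Prod.smul_fst, Prod.smul_snd,
      smul_eq_mul, Prod.fst_sub, Prod.snd_sub]; ring
  have c2 : cross v₂ Y = t * (cross v₂ v₃ + cross v₁ v₂) := by
    rw [hYdef]; simp only [cross, Prod.fst_add, Prod.snd_add, Prod.smul_fst, Prod.smul_snd,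
      smul_eq_mul, Prod.fst_sub, Prod.snd_sub]; ring
  have c3 : cross Y v₃ = s * cross v₃ v₄ := by
    rw [hY]; simp only [cross, Prod.fst_add, Prod.snd_add, Prod.smul_fst, Prod.smul_snd,
      smul_eq_mul, Prod.fst_sub, Prod.snd_sub]; ring
  have c4 : cross Y v₄ = (1 + s) * cross v₃ v₄ := by
    rw [hY]; simp only [cross, Prod.fst_add, Prod.snd_add, Prod.smul_fst, Prod.smul_snd,
      smul_eq_mul, Prod.fst_sub, Prod.snd_sub]; ring
  have c5 : turn v₀ v₁ Y = turn v₀ v₁ v₂ + t * turn v₀ v₁ v₃ := by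
    rw [hYdef]; simp only [turn, cross, Prod.fst_add, Prod.snd_add, Prod.smul_fst, Prod.smul_snd,
      smul_eq_mul, Prod.fst_sub, Prod.snd_sub]; ring
  have c6 : turn v₁ Y v₄ = (1 + s) * turn v₁ v₃ v₄ := by
    rw [hY]; simp only [turn, cross, Prod.fst_add, Prod.snd_add, Prod.smul_fst, Prod.smul_snd,
      smul_eq_mul, Prod.fst_sub, Prod.snd_sub]; ring
  have c7 : turn Y v₃ v₄ = 0 := by
    rw [hY]; simp only [turn, cross, Prod.fst_add, Prod.snd_add, Prod.smul_fst, Prod.smul_snd,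
      smul_eq_mul, Prod.fst_sub, Prod.snd_sub]; ring
  refine ⟨t, ht0.eq_or_lt.imp_left Eq.symm, fun h => ?_, ?_, c7, by rw [c4]; positivity⟩
  · rw [ht, div_eq_zero_iff] at h
    exact h.resolve_right hE.ne'
  refine ⟨⟨1, 0, by simp⟩, ⟨cross Y v₃ / cross v₂ v₃, cross v₂ Y / cross v₂ v₃, ?_, ?_, ?_, ?_⟩,
    ?_, ?_, ?_, ⟨1, by simp⟩, ⟨1 + s, by positivity, ?_⟩⟩
  · rw [c3]; positivity
  · rw [c2]; positivity
  · rw [c2, c3]; positivity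
  · exact eq_cross_combination h₂₃.ne' _
  · rw [c1]; positivity
  · rw [c5]; positivity
  · rw [c6]; positivity
  · exact hY.trans (by module)

lemma reduction_left (h₀₁ : 0 < cross v₀ v₁) (h₁₂ : 0 < cross v₁ v₂) (h₂₃ : 0 < cross v₂ v₃)
    (h₃₄ : 0 < cross v₃ v₄) (h₁₃ : 0 < cross v₁ v₃) (k₁ : 0 ≤ turn v₀ v₁ v₂)
    (k₂ : 0 < turn v₁ v₂ v₃) (k₃ : 0 ≤ turn v₂ v₃ v₄) :
    ∃ t : ℝ, (t = 0 ∨ t < 0) ∧ (t = 0 → turn v₀ v₁ v₂ = 0) ∧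
      Reduction v₀ v₁ v₂ v₃ v₄ (v₂ + t • (v₃ - v₁)) v₃ ∧
      turn v₀ v₁ (v₂ + t • (v₃ - v₁)) = 0 ∧ 0 < cross v₀ (v₂ + t • (v₃ - v₁)) := by
  rw [← cross_swap_swap] at h₀₁ h₁₂ h₂₃ h₃₄ h₁₃
  rw [← turn_swap_swap] at k₁ k₂ k₃
  obtain ⟨t, h1, h2, h3, h4, h5⟩ := reduction_right h₃₄ h₂₃ h₁₂ h₀₁ h₁₃ k₃ k₂ k₁
  have e : v₂.swap + t • (v₁.swap - v₃.swap) = (v₂ + (-t) • (v₃ - v₁)).swap := by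
    ext <;> simp <;> ring
  rw [e] at h3 h4 h5
  rw [turn_swap_swap] at h4
  rw [cross_swap_swap] at h5
  refine ⟨-t, h1.imp (fun h => by simp [h]) (fun h => by linarith), fun h => ?_, h3.swap, h4, h5⟩
  rw [← turn_swap_swap]
  exact h2 (by linarith)

end chain

lemma ne_zero_of_cross_pos_left {u v : ℝ × ℝ} (h : 0 < cross u v) : u ≠ 0 := by
  rintro rfl; simp [cross] at h

lemma ne_zero_of_cross_pos_right {u v : ℝ × ℝ} (h : 0 < cross u v) : v ≠ 0 := by
  rintro rfl; simp [cross] at h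

lemma ae_coneTerm_merge {u v w : ℝ × ℝ} (huw : 0 < cross u w) (hv : v ≠ 0)
    (h : turn u v w = 0) :
    ∀ᵐ y : ℝ × ℝ, coneTerm u v y + coneTerm v w y = coneTerm u w y := by
  have hself : ∀ u y : ℝ × ℝ, coneTerm u u y = 0 := fun u y => by
    simp [coneTerm, cross, mul_comm]
  rcases eq_or_ne u v with rfl | huv
  · simp [hself]
  rcases eq_or_ne v w with rfl | hvw
  · simp [hself]
  have hne : u ≠ w := by rintro rfl; simp [cross, mul_comm] at huw
  filter_upwards [ae_coneTerm_add_coneTerm (ne_zero_of_cross_pos_left huw) hv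
    (ne_zero_of_cross_pos_right huw) huv hvw hne] with y hy
  rw [hy, show cross u v + cross v w - cross u w = 0 from h, zero_mul, add_zero]

/-- One vertex of a convex chain of five vertices can be removed without increasing the
functional. -/
lemma exists_reduction {q : ℝ} (hq : 0 < q) {R : ℝ × ℝ → ℝ} (hR : EvenLogConvex R)
    {v₀ v₁ v₂ v₃ v₄ : ℝ × ℝ} (h₀₁ : 0 < cross v₀ v₁) (h₁₂ : 0 < cross v₁ v₂)
    (h₂₃ : 0 < cross v₂ v₃) (h₃₄ : 0 < cross v₃ v₄) (h₁₃ : 0 < cross v₁ v₃)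
    (k₁ : 0 ≤ turn v₀ v₁ v₂) (k₂ : 0 ≤ turn v₁ v₂ v₃) (k₃ : 0 ≤ turn v₂ v₃ v₄) :
    ∃ X Y, Reduction v₀ v₁ v₂ v₃ v₄ X Y ∧
      cross v₀ X + cross X Y + cross Y v₄ =
        cross v₀ v₁ + cross v₁ v₂ + cross v₂ v₃ + cross v₃ v₄ ∧
      ∫ y, (R y + (coneTerm v₀ X y + coneTerm X Y y + coneTerm Y v₄ y)) ^ (-q) ≤
      ∫ y, (R y + (coneTerm v₀ v₁ y + coneTerm v₁ v₂ y + coneTerm v₂ v₃ y +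
        coneTerm v₃ v₄ y)) ^ (-q) := by
  rcases k₂.eq_or_lt with k₂ | k₂
  · refine ⟨v₁, v₃, reduction_middle h₀₁ h₁₂ h₂₃ h₃₄ h₁₃ k₁ k₂.le k₃, ?_, ?_⟩
    · simp only [turn] at k₂; linarith
    · refine le_of_eq (integral_congr_ae ?_)
      filter_upwards [ae_coneTerm_merge h₁₃ (ne_zero_of_cross_pos_left h₂₃) k₂.symm] with y hy
      rw [← hy]; ring_nf
  obtain ⟨t, ht, ht0, hr, hrt, hrc⟩ := reduction_right h₀₁ h₁₂ h₂₃ h₃₄ h₁₃ k₁ k₂ k₃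
  obtain ⟨s, hs, hs0, hl, hlt, hlc⟩ := reduction_left h₀₁ h₁₂ h₂₃ h₃₄ h₁₃ k₁ k₂ k₃
  set Y := v₂ + t • (v₃ - v₁) with hY
  set X := v₂ + s • (v₃ - v₁) with hX
  have hchord : ∀ t : ℝ, cross v₁ (v₂ + t • (v₃ - v₁)) + cross (v₂ + t • (v₃ - v₁)) v₃ =
      cross v₁ v₂ + cross v₂ v₃ := by
    intro t
    simp only [cross, Prod.fst_add, Prod.snd_add, Prod.smul_fst, Prod.smul_snd, smul_eq_mul,
      Prod.fst_sub, Prod.snd_sub]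
    ring
  have aY := hchord t
  have aX := hchord s
  rw [← hY] at aY
  rw [← hX] at aX
  have iY : ∫ y, (R y + (coneTerm v₀ v₁ y + coneTerm v₁ Y y + coneTerm Y v₄ y)) ^ (-q) =
      ∫ y, ((R y + (coneTerm v₀ v₁ y + coneTerm v₃ v₄ y)) +
        (coneTerm v₁ Y y + coneTerm Y v₃ y)) ^ (-q) := by
    refine integral_congr_ae ?_
    filter_upwards [ae_coneTerm_merge hrc (ne_zero_of_cross_pos_left h₃₄) hrt] with y hy
    rw [← hy]; ring_nf
  have iX : ∫ y, (R y + (coneTerm v₀ X y + coneTerm X v₃ y + coneTerm v₃ v₄ y)) ^ (-q) =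
      ∫ y, ((R y + (coneTerm v₀ v₁ y + coneTerm v₃ v₄ y)) +
        (coneTerm v₁ X y + coneTerm X v₃ y)) ^ (-q) := by
    refine integral_congr_ae ?_
    filter_upwards [ae_coneTerm_merge hlc (ne_zero_of_cross_pos_left h₁₂) hlt] with y hy
    rw [← hy]; ring_nf
  have iV : ∫ y, (R y + (coneTerm v₀ v₁ y + coneTerm v₁ v₂ y + coneTerm v₂ v₃ y +
        coneTerm v₃ v₄ y)) ^ (-q) =
      ∫ y, ((R y + (coneTerm v₀ v₁ y + coneTerm v₃ v₄ y)) +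
        (coneTerm v₁ v₂ y + coneTerm v₂ v₃ y)) ^ (-q) := by
    refine integral_congr_ae (ae_of_all _ fun y => ?_)
    simp only; ring_nf
  have arY : cross v₀ v₁ + cross v₁ Y + cross Y v₄ =
      cross v₀ v₁ + cross v₁ v₂ + cross v₂ v₃ + cross v₃ v₄ := by
    simp only [turn] at hrt; linarith
  have arX : cross v₀ X + cross X v₃ + cross v₃ v₄ =
      cross v₀ v₁ + cross v₁ v₂ + cross v₂ v₃ + cross v₃ v₄ := by
    simp only [turn] at hlt; linarith
  rcases ht with ht | ht
  · refine ⟨v₁, Y, hr, arY, ?_⟩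
    rw [iY, iV, hY, ht, zero_smul, add_zero]
  rcases hs with hs | hs
  · refine ⟨X, v₃, hl, arX, ?_⟩
    rw [iX, iV, hX, hs, zero_smul, add_zero]
  have key := integral_rpow_vertex_move hq
    (hR.add ((evenLogConvex_coneTerm h₀₁.le).add (evenLogConvex_coneTerm h₃₄.le))) h₁₃ k₂ hs ht
    (ne_zero_of_cross_pos_left h₂₃) (ne_zero_of_cross_pos_right hlc)
    (ne_zero_of_cross_pos_left hrc)
  rcases min_le_iff.1 key with key | key
  · exact ⟨X, v₃, hl, arX, by rw [iX, iV]; exact key⟩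
  · exact ⟨v₁, Y, hr, arY, by rw [iY, iV]; exact key⟩

/-- A centrally symmetric convex polygon with vertices `v 0, …, v (m - 1)` and their negatives. -/
structure SymPolygon (m : ℕ) (v : ℕ → ℝ × ℝ) : Prop where
  close : v m = -v 0
  cross_pos : ∀ i j, i < j → j < m → 0 < cross (v i) (v j)
  convex : ∀ i, i + 2 ≤ m → 0 ≤ turn (v i) (v (i + 1)) (v (i + 2))
  wrap : 0 ≤ turn (v (m - 1)) (-v 0) (-v 1)

/-- The exponential integral of a symmetric polygon. -/
noncomputable def polygonExp (m : ℕ) (v : ℕ → ℝ × ℝ) (y : ℝ × ℝ) : ℝ :=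
  ∑ i ∈ Finset.range m, coneTerm (v i) (v (i + 1)) y

/-- The area of a symmetric polygon. -/
def polygonArea (m : ℕ) (v : ℕ → ℝ × ℝ) : ℝ :=
  ∑ i ∈ Finset.range m, cross (v i) (v (i + 1))

/-- Replace the vertices `v 1, v 2, v 3` by `X, Y`. -/
def splice (v : ℕ → ℝ × ℝ) (X Y : ℝ × ℝ) : ℕ → ℝ × ℝ
  | 0 => v 0
  | 1 => X
  | 2 => Y
  | n + 3 => v (n + 4)

lemma cross_neg_right (u v : ℝ × ℝ) : cross u (-v) = cross v u := by
  simp only [cross, Prod.fst_neg, Prod.snd_neg]; ring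

lemma cross_smul_add_left (a b : ℝ) (u v w : ℝ × ℝ) :
    cross (a • u + b • v) w = a * cross u w + b * cross v w := by
  simp only [cross, Prod.fst_add, Prod.snd_add, Prod.smul_fst, Prod.smul_snd, smul_eq_mul]; ring

lemma cross_smul_add_right (a b : ℝ) (u v w : ℝ × ℝ) :
    cross w (a • u + b • v) = a * cross w u + b * cross w v := by
  simp only [cross, Prod.fst_add, Prod.snd_add, Prod.smul_fst, Prod.smul_snd, smul_eq_mul]; ring

lemma turn_ray_left (k : ℝ) (u v w : ℝ × ℝ) : turn (v + k • (u - v)) v w = k * turn u v w := by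
  simp only [turn, cross, Prod.fst_add, Prod.snd_add, Prod.smul_fst, Prod.smul_snd, smul_eq_mul,
    Prod.fst_sub, Prod.snd_sub]; ring

lemma combination_pos {a b x y : ℝ} (ha : 0 ≤ a) (hb : 0 ≤ b) (hab : 0 < a + b) (hx : 0 < x)
    (hy : 0 < y) : 0 < a * x + b * y := by
  rcases ha.eq_or_lt with rfl | ha
  · have : 0 < b := by linarith
    positivity
  · positivity

namespace SymPolygon

variable {m : ℕ} {v : ℕ → ℝ × ℝ}

lemma cross_pos' (h : SymPolygon m v) {i j : ℕ} (hij : i < j) (hj : j ≤ m)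
    (h0 : 0 < i ∨ j < m) : 0 < cross (v i) (v j) := by
  rcases hj.eq_or_lt with rfl | hj
  · rw [h.close, cross_neg_right]
    exact h.cross_pos 0 i (by omega) hij
  · exact h.cross_pos i j hij hj

lemma splice {n : ℕ} (h : SymPolygon (n + 4) v) {X Y : ℝ × ℝ}
    (r : Reduction (v 0) (v 1) (v 2) (v 3) (v 4) X Y) :
    SymPolygon (n + 3) (LpMahler.splice v X Y) := by
  obtain ⟨a, b, ha, hb, hab, hX⟩ := r.left_cone
  obtain ⟨c, d, hc, hd, hcd, hY⟩ := r.right_cone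
  obtain ⟨k, hk, hXk⟩ := r.left_ray
  obtain ⟨l, hl, hYl⟩ := r.right_ray
  refine ⟨h.close, ?_, ?_, ?_⟩
  · intro i j hij hj
    match i, j, hij, hj with
    | 0, 1, _, _ =>
      simp only [LpMahler.splice]
      rw [hX, cross_smul_add_right]
      exact combination_pos ha hb hab (h.cross_pos _ _ (by omega) (by omega))
        (h.cross_pos _ _ (by omega) (by omega))
    | 0, 2, _, _ =>
      simp only [LpMahler.splice]
      rw [hY, cross_smul_add_right]
      exact combination_pos hc hd hcd (h.cross_pos _ _ (by omega) (by omega))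
        (h.cross_pos _ _ (by omega) (by omega))
    | 0, j + 3, _, hj => exact h.cross_pos _ _ (by omega) (by omega)
    | 1, 2, _, _ => exact r.cross_pos
    | 1, j + 3, _, hj =>
      simp only [LpMahler.splice]
      rw [hX, cross_smul_add_left]
      exact combination_pos ha hb hab (h.cross_pos _ _ (by omega) (by omega))
        (h.cross_pos _ _ (by omega) (by omega))
    | 2, j + 3, _, hj =>
      simp only [LpMahler.splice]
      rw [hY, cross_smul_add_left]
      exact combination_pos hc hd hcd (h.cross_pos _ _ (by omega) (by omega))
        (h.cross_pos _ _ (by omega) (by omega))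
    | i + 3, j + 3, hij, hj => exact h.cross_pos _ _ (by omega) (by omega)
  · intro i hi
    match i, hi with
    | 0, _ => exact r.left_turn
    | 1, _ => exact r.right_turn
    | 2, hi =>
      simp only [LpMahler.splice]
      rw [hYl, turn_ray_left]
      exact mul_nonneg hl.le (h.convex 3 (by omega))
    | i + 3, hi => exact h.convex (i + 4) (by omega)
  · have key : ∀ w : ℝ × ℝ, turn w (-v 0) (-X) = k * turn w (-v 0) (-v 1) := by
      intro w
      rw [hXk]
      simp only [turn, cross, Prod.fst_add, Prod.snd_add, Prod.smul_fst, Prod.smul_snd,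
        smul_eq_mul, Prod.fst_sub, Prod.snd_sub, Prod.fst_neg, Prod.snd_neg]
      ring
    match n, h with
    | 0, h =>
      change 0 ≤ turn Y (-v 0) (-X)
      rw [key, hYl, h.close, turn_ray_left]
      exact mul_nonneg hk.le (mul_nonneg hl.le h.wrap)
    | n + 1, h =>
      change 0 ≤ turn (v (n + 4)) (-v 0) (-X)
      rw [key]
      exact mul_nonneg hk.le h.wrap

lemma area_nonneg (h : SymPolygon m v) (hm : 2 ≤ m) : 0 ≤ polygonArea m v :=
  Finset.sum_nonneg fun i hi => by
    rw [Finset.mem_range] at hi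
    exact (h.cross_pos' (Nat.lt_succ_self i) hi (by omega)).le

/-- Hexagons. -/
lemma parallelogramValue_le_three {q : ℝ} (hq : 0 < q) (h : SymPolygon 3 v) :
    parallelogramValue q ≤ polygonArea 3 v ^ (1 + q) * ∫ y, polygonExp 3 v y ^ (-q) := by
  have hclose := h.close
  have h01 := h.cross_pos 0 1 (by norm_num) (by norm_num)
  have h02 := h.cross_pos 0 2 (by norm_num) (by norm_num)
  have h12 := h.cross_pos 1 2 (by norm_num) (by norm_num)
  have k1 := h.convex 0 (by norm_num)
  have k2 := h.convex 1 (by norm_num)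
  have k0 := h.wrap
  simp only [polygonArea, polygonExp, Finset.sum_range_succ, Finset.sum_range_zero, zero_add]
  norm_num at *
  rw [hclose] at *
  generalize v 0 = a at *
  generalize v 1 = b at *
  generalize v 2 = c at *
  have hneg : ∀ x y : ℝ × ℝ, cross (-x) (-y) = cross x y := fun x y => by
    simp only [cross, Prod.fst_neg, Prod.snd_neg]; ring
  have hneg' : ∀ x y : ℝ × ℝ, cross (-x) y = cross y x := fun x y => by
    simp only [cross, Prod.fst_neg, Prod.snd_neg]; ring
  have finish : ∀ X Y : ℝ × ℝ, 0 < cross X Y →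
      2 * cross X Y = cross a b + cross b c + cross c (-a) →
      ∫ y, (coneTerm X Y y + coneTerm Y (-X) y) ^ (-q) ≤
        ∫ y, (coneTerm a b y + coneTerm b c y + coneTerm c (-a) y) ^ (-q) →
      parallelogramValue q ≤ (cross a b + cross b c + cross c (-a)) ^ (1 + q) *
        ∫ y, (coneTerm a b y + coneTerm b c y + coneTerm c (-a) y) ^ (-q) := by
    intro X Y hXY e hle
    rw [← parallelogram_eq q hXY, e]
    refine mul_le_mul_of_nonneg_left hle (Real.rpow_nonneg ?_ _)
    rw [← e]; positivity
  have hca : 0 < cross c (-a) := by rwa [cross_neg_right]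
  have hac : 0 < cross (-c) a := by rwa [hneg']
  have k0' : 0 ≤ turn (-c) a b := by
    simp only [turn, cross, Prod.fst_neg, Prod.snd_neg] at k0 ⊢; linarith
  rcases k1.eq_or_lt with k1 | k1
  · refine finish a c h02 ?_ (le_of_eq (integral_congr_ae ?_))
    · rw [cross_neg_right]; simp only [turn] at k1; linarith
    · filter_upwards [ae_coneTerm_merge h02 (ne_zero_of_cross_pos_left h12) k1.symm] with y hy
      rw [← hy]
  obtain ⟨t, ht, ht0, hr, hrt, hrc⟩ := reduction_right hac h01 h12 hca h02 k0' k1 k2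
  obtain ⟨s, hs, hs0, hl, hlt, hlc⟩ := reduction_left hac h01 h12 hca h02 k0' k1 k2
  set Y := b + t • (c - a) with hY
  set X := b + s • (c - a) with hX
  have hchord : ∀ t : ℝ, cross a (b + t • (c - a)) + cross (b + t • (c - a)) c =
      cross a b + cross b c := by
    intro t
    simp only [cross, Prod.fst_add, Prod.snd_add, Prod.smul_fst, Prod.smul_snd, smul_eq_mul,
      Prod.fst_sub, Prod.snd_sub]
    ring
  have aY := hchord t
  have aX := hchord s
  rw [← hY] at aY
  rw [← hX] at aX
  have iY : ∫ y, (coneTerm a Y y + coneTerm Y (-a) y) ^ (-q) =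
      ∫ y, (coneTerm c (-a) y + (coneTerm a Y y + coneTerm Y c y)) ^ (-q) := by
    refine integral_congr_ae ?_
    filter_upwards [ae_coneTerm_merge hrc (ne_zero_of_cross_pos_left hca) hrt] with y hy
    rw [← hy]; ring_nf
  have iX : ∫ y, (coneTerm X c y + coneTerm c (-X) y) ^ (-q) =
      ∫ y, (coneTerm c (-a) y + (coneTerm a X y + coneTerm X c y)) ^ (-q) := by
    refine integral_congr_ae ?_
    filter_upwards [ae_coneTerm_merge hlc (ne_zero_of_cross_pos_left h01) hlt] with y hy
    have e1 := coneTerm_neg_neg c (-X) y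
    have e2 := coneTerm_neg_neg c (-a) y
    rw [neg_neg] at e1 e2
    rw [← e1, ← hy, e2]; ring_nf
  have iV : ∫ y, (coneTerm a b y + coneTerm b c y + coneTerm c (-a) y) ^ (-q) =
      ∫ y, (coneTerm c (-a) y + (coneTerm a b y + coneTerm b c y)) ^ (-q) := by
    refine integral_congr_ae (ae_of_all _ fun y => ?_)
    simp only; ring_nf
  have arY : 2 * cross a Y = cross a b + cross b c + cross c (-a) := by
    simp only [turn, cross_neg_right] at hrt ⊢; linarith
  have arX : 2 * cross X c = cross a b + cross b c + cross c (-a) := by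
    simp only [turn, cross_neg_right, hneg'] at hlt ⊢; linarith
  have pY : 0 < cross a Y := by rwa [cross_neg_right] at hrc
  have pX : 0 < cross X c := by rwa [hneg'] at hlc
  rcases ht with ht | ht
  · refine finish a Y pY arY ?_
    rw [iY, iV, hY, ht, zero_smul, add_zero]
  rcases hs with hs | hs
  · refine finish X c pX arX ?_
    rw [iX, iV, hX, hs, zero_smul, add_zero]
  have key := integral_rpow_vertex_move hq (evenLogConvex_coneTerm hca.le) h02 k1 hs ht
    (ne_zero_of_cross_pos_left h12) (ne_zero_of_cross_pos_right hlc)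
    (ne_zero_of_cross_pos_left hrc)
  rcases min_le_iff.1 key with key | key
  · exact finish X c pX arX (by rw [iX, iV]; exact key)
  · exact finish a Y pY arY (by rw [iY, iV]; exact key)

/-- Parallelograms minimize the functional among symmetric polygons. -/
theorem parallelogramValue_le {q : ℝ} (hq : 0 < q) (n : ℕ) : ∀ {v : ℕ → ℝ × ℝ},
    SymPolygon (n + 3) v →
    parallelogramValue q ≤ polygonArea (n + 3) v ^ (1 + q) * ∫ y, polygonExp (n + 3) v y ^ (-q) := by
  induction n with
  | zero => exact fun h => parallelogramValue_le_three hq h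
  | succ n ih =>
    intro v h
    have hp : ∀ i j, i < j → j ≤ n + 4 → (0 < i ∨ j < n + 4) → 0 < cross (v i) (v j) :=
      fun i j h1 h2 h3 => h.cross_pos' h1 h2 h3
    have hR : EvenLogConvex fun y => ∑ i ∈ Finset.range n, coneTerm (v (i + 4)) (v (i + 5)) y := by
      refine EvenLogConvex.sum _ fun i hi => evenLogConvex_coneTerm (hp _ _ ?_ ?_ ?_).le
      · omega
      · rw [Finset.mem_range] at hi; omega
      · omega
    obtain ⟨X, Y, r, har, hInt⟩ := exists_reduction hq hR (hp 0 1 (by omega) (by omega) (by omega))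
      (hp 1 2 (by omega) (by omega) (by omega)) (hp 2 3 (by omega) (by omega) (by omega))
      (hp 3 4 (by omega) (by omega) (by omega)) (hp 1 3 (by omega) (by omega) (by omega))
      (h.convex 0 (by omega)) (h.convex 1 (by omega)) (h.convex 2 (by omega))
    have hs := h.splice r
    refine (ih hs).trans ?_
    have eA : polygonArea (n + 3) (LpMahler.splice v X Y) = polygonArea (n + 4) v := by
      simp only [polygonArea, Finset.sum_range_succ', LpMahler.splice]
      rw [show (0 + 1 : ℕ) = 1 from rfl]
      simp only [add_assoc, Nat.reduceAdd, zero_add] at har ⊢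
      linarith
    have eN : ∀ y, polygonExp (n + 3) (LpMahler.splice v X Y) y =
        (∑ i ∈ Finset.range n, coneTerm (v (i + 4)) (v (i + 5)) y) +
          (coneTerm (v 0) X y + coneTerm X Y y + coneTerm Y (v 4) y) := by
      intro y
      simp only [polygonExp, Finset.sum_range_succ', LpMahler.splice]
      ring
    have eO : ∀ y, polygonExp (n + 4) v y =
        (∑ i ∈ Finset.range n, coneTerm (v (i + 4)) (v (i + 5)) y) +
          (coneTerm (v 0) (v 1) y + coneTerm (v 1) (v 2) y + coneTerm (v 2) (v 3) y +
            coneTerm (v 3) (v 4) y) := by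
      intro y
      simp only [polygonExp, Finset.sum_range_succ']
      ring
    rw [eA]
    change _ ≤ polygonArea (n + 4) v ^ (1 + q) * ∫ y, polygonExp (n + 4) v y ^ (-q)
    simp only [eN, eO]
    exact mul_le_mul_of_nonneg_left hInt (Real.rpow_nonneg (h.area_nonneg (by omega)) _)

end SymPolygon

/-- The exponential integral of a body. -/
noncomputable def bodyExp (K : Set (ℝ × ℝ)) (y : ℝ × ℝ) : ℝ := ∫ x in K, Real.exp (dot x y)

/-- The triangle with vertices `0, u, v`, in terms of the coordinates with respect to `u, v`. -/
def triangle (u v : ℝ × ℝ) : Set (ℝ × ℝ) :=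
  {x | 0 ≤ cross x v ∧ 0 ≤ cross u x ∧ cross x v + cross u x ≤ cross u v}

/-- The triangle with vertices `0, u, v` without the edges at `0`. -/
def openTriangle (u v : ℝ × ℝ) : Set (ℝ × ℝ) :=
  {x | 0 < cross x v ∧ 0 < cross u x ∧ cross x v + cross u x ≤ cross u v}

lemma continuous_cross_left (u : ℝ × ℝ) : Continuous (cross u) := by
  unfold cross; fun_prop

lemma continuous_cross_right (u : ℝ × ℝ) : Continuous fun x => cross x u := by
  unfold cross; fun_prop

lemma measurableSet_triangle (u v : ℝ × ℝ) : MeasurableSet (triangle u v) :=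
  (measurableSet_le measurable_const (continuous_cross_right v).measurable).inter
    ((measurableSet_le measurable_const (continuous_cross_left u).measurable).inter
      (measurableSet_le ((continuous_cross_right v).add (continuous_cross_left u)).measurable
        measurable_const))

lemma measurableSet_openTriangle (u v : ℝ × ℝ) : MeasurableSet (openTriangle u v) :=
  (measurableSet_lt measurable_const (continuous_cross_right v).measurable).inter
    ((measurableSet_lt measurable_const (continuous_cross_left u).measurable).inter
      (measurableSet_le ((continuous_cross_right v).add (continuous_cross_left u)).measurable
        measurable_const))

lemma ae_cross_ne_zero {u : ℝ × ℝ} (hu : u ≠ 0) : ∀ᵐ x : ℝ × ℝ, cross u x ≠ 0 := by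
  have : ((-u.2, u.1) : ℝ × ℝ) ≠ 0 := by
    intro h
    simp only [Prod.mk_eq_zero, neg_eq_zero] at h
    exact hu (Prod.ext h.2 h.1)
  filter_upwards [ae_dot_ne_zero this] with x hx
  convert hx using 1
  simp only [cross, dot]; ring

lemma cross_swap (u v : ℝ × ℝ) : cross u v = -cross v u := by
  simp only [cross]; ring

lemma openTriangle_ae_eq {u v : ℝ × ℝ} (h : 0 < cross u v) :
    openTriangle u v =ᵐ[volume] triangle u v := by
  filter_upwards [ae_cross_ne_zero (ne_zero_of_cross_pos_left h),
    ae_cross_ne_zero (ne_zero_of_cross_pos_right h)] with x h1 h2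
  apply propext
  change (0 < cross x v ∧ 0 < cross u x ∧ _) ↔ (0 ≤ cross x v ∧ 0 ≤ cross u x ∧ _)
  rw [cross_swap v, neg_ne_zero] at h2
  constructor
  · exact fun ⟨a, b, c⟩ => ⟨a.le, b.le, c⟩
  · exact fun ⟨a, b, c⟩ => ⟨lt_of_le_of_ne a h2.symm, lt_of_le_of_ne b h1.symm, c⟩

lemma setIntegral_triangle {u v : ℝ × ℝ} (h : 0 < cross u v) (y : ℝ × ℝ) :
    ∫ x in triangle u v, Real.exp (dot x y) = cross u v * triExp 0 (dot u y) (dot v y) := by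
  rw [← integral_indicator (measurableSet_triangle u v)]
  have hr : cross (u.1, v.1) (u.2, v.2) = cross u v := by simp only [cross]; ring
  have key := integral_comp_dot (u := (u.1, v.1)) (v := (u.2, v.2)) (by rw [hr]; exact h.ne')
    ((triangle u v).indicator fun x => Real.exp (dot x y))
  rw [hr, abs_of_pos h] at key
  have e : ∀ z : ℝ × ℝ, (triangle u v).indicator (fun x => Real.exp (dot x y))
      (dot (u.1, v.1) z, dot (u.2, v.2) z) =
      stdTriangle.indicator (fun x => Real.exp (0 + x.1 * (dot u y - 0) + x.2 * (dot v y - 0))) z := by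
    intro z
    have c1 : cross (dot (u.1, v.1) z, dot (u.2, v.2) z) v = z.1 * cross u v := by
      simp only [cross, dot]; ring
    have c2 : cross u (dot (u.1, v.1) z, dot (u.2, v.2) z) = z.2 * cross u v := by
      simp only [cross, dot]; ring
    have hmem : (dot (u.1, v.1) z, dot (u.2, v.2) z) ∈ triangle u v ↔ z ∈ stdTriangle := by
      simp only [triangle, stdTriangle, mem_ofPred_eq, c1, c2, ← add_mul]
      rw [mul_nonneg_iff_of_pos_right h, mul_nonneg_iff_of_pos_right h, mul_le_iff_le_one_left h]
    by_cases hz : z ∈ stdTriangle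
    · rw [indicator_of_mem hz, indicator_of_mem (hmem.2 hz)]
      congr 1
      simp only [dot]; ring
    · rw [indicator_of_notMem hz, indicator_of_notMem (hmem.not.2 hz)]
  simp only [e] at key
  rw [integral_indicator measurableSet_stdTriangle] at key
  rw [triExp, key]
  field_simp

lemma dot_neg_left (u y : ℝ × ℝ) : dot (-u) y = -dot u y := by
  simp only [dot, Prod.fst_neg, Prod.snd_neg]; ring

lemma setIntegral_neg_exp (S : Set (ℝ × ℝ)) (y : ℝ × ℝ) :
    ∫ x in -S, Real.exp (dot x y) = ∫ x in S, Real.exp (dot x (-y)) := by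
  have := (Measure.measurePreserving_neg (volume : Measure (ℝ × ℝ))).setIntegral_preimage_emb
    (MeasurableEquiv.neg (ℝ × ℝ)).measurableEmbedding (fun x => Real.exp (dot x (-y))) S
  rw [← this]
  simp only [dot_neg, dot_neg_left, neg_neg]
  rfl

lemma coneTerm_eq_add {u v : ℝ × ℝ} (h : 0 < cross u v) (y : ℝ × ℝ) :
    coneTerm u v y = (∫ x in triangle u v, Real.exp (dot x y)) +
      ∫ x in triangle u v, Real.exp (dot x (-y)) := by
  rw [setIntegral_triangle h, setIntegral_triangle h, coneTerm, coneExp, dot_neg, dot_neg]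
  ring

lemma integrableOn_exp_dot {K : Set (ℝ × ℝ)} (hK : IsCompact K) (y : ℝ × ℝ) :
    IntegrableOn (fun x => Real.exp (dot x y)) K := by
  refine Continuous.continuousOn ?_ |>.integrableOn_compact hK
  unfold dot; fun_prop

lemma eq_combination_of_mem_triangle {u v x : ℝ × ℝ} (h : 0 < cross u v) (hx : x ∈ triangle u v) :
    ∃ s t : ℝ, 0 ≤ s ∧ 0 ≤ t ∧ s + t ≤ 1 ∧ x = s • u + t • v :=
  ⟨_, _, div_nonneg hx.1 h.le, div_nonneg hx.2.1 h.le, by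
    rw [← add_div, div_le_one h]; exact hx.2.2, eq_cross_combination h.ne' x⟩

lemma triangle_subset {K : Set (ℝ × ℝ)} (hK : Convex ℝ K) (h0 : (0 : ℝ × ℝ) ∈ K) {u v : ℝ × ℝ}
    (h : 0 < cross u v) (hu : u ∈ K) (hv : v ∈ K) : triangle u v ⊆ K := by
  intro x hx
  obtain ⟨s, t, hs, ht, hst, rfl⟩ := eq_combination_of_mem_triangle h hx
  have := hK.sum_mem (t := Finset.univ) (w := ![s, t, 1 - s - t]) (z := ![u, v, 0]) ?_ ?_ ?_
  · simpa [Fin.sum_univ_three] using this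
  · intro i _; fin_cases i <;> simp <;> linarith
  · simp [Fin.sum_univ_three]
  · intro i _; fin_cases i <;> simp [hu, hv, h0]

lemma openTriangle_subset (u v : ℝ × ℝ) : openTriangle u v ⊆ triangle u v :=
  fun _ hx => ⟨hx.1.le, hx.2.1.le, hx.2.2⟩

/-- The exponential integral of an inscribed symmetric polygon is at most that of the body. -/
lemma SymPolygon.polygonExp_le_bodyExp {m : ℕ} {v : ℕ → ℝ × ℝ} (h : SymPolygon m v) (hm : 2 ≤ m)
    {K : Set (ℝ × ℝ)} (hc : IsCompact K) (hK : Convex ℝ K) (hs : K = -K)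
    (h0 : (0 : ℝ × ℝ) ∈ K) (hv : ∀ i, v i ∈ K) (y : ℝ × ℝ) :
    polygonExp m v y ≤ bodyExp K y := by
  have hp : ∀ i < m, 0 < cross (v i) (v (i + 1)) := fun i hi =>
    h.cross_pos' (Nat.lt_succ_self i) hi (by omega)
  set P := ⋃ i ∈ Finset.range m, openTriangle (v i) (v (i + 1)) with hP
  have hPm : MeasurableSet P := Finset.measurableSet_biUnion _ fun i _ =>
    measurableSet_openTriangle _ _
  have hPK : P ⊆ K := by
    rw [hP]
    refine iUnion₂_subset fun i hi => (openTriangle_subset _ _).trans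
      (triangle_subset hK h0 (hp i (Finset.mem_range.1 hi)) (hv _) (hv _))
  have hPK' : -P ⊆ K := by rw [hs]; exact neg_subset_neg.2 hPK
  have hneg : ∀ i < m, ∀ j < m, i < j → ∀ x ∈ openTriangle (v i) (v (i + 1)),
      cross (v j) x < 0 := by
    intro i hi j hj hij x hx
    rw [eq_cross_combination (hp i hi).ne' x, cross_smul_add_right]
    have d := hp i hi
    have h1 : cross (v j) (v i) < 0 := by
      rw [cross_swap, neg_lt_zero]; exact h.cross_pos i j hij hj
    have h2 : cross (v j) (v (i + 1)) ≤ 0 := by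
      rcases (show i + 1 ≤ j from hij).eq_or_lt with e | e
      · rw [e]; simp [cross, mul_comm]
      · rw [cross_swap, neg_nonpos]; exact (h.cross_pos _ j e hj).le
    have h3 := mul_neg_of_pos_of_neg (div_pos hx.1 d) h1
    have h4 := mul_nonpos_of_nonneg_of_nonpos (div_pos hx.2.1 d).le h2
    linarith
  have hdisj : (↑(Finset.range m) : Set ℕ).Pairwise
      (Function.onFun Disjoint fun i => openTriangle (v i) (v (i + 1))) := by
    intro i hi j hj hij
    rw [Finset.coe_range, mem_Iio] at hi hj
    rw [Function.onFun, Set.disjoint_left]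
    intro x hx hx'
    rcases lt_or_gt_of_ne hij with hij | hij
    · exact (hneg i hi j hj hij x hx).not_gt hx'.2.1
    · exact (hneg j hj i hi hij x hx').not_gt hx.2.1
  have hsum : ∀ z : ℝ × ℝ, ∫ x in P, Real.exp (dot x z) =
      ∑ i ∈ Finset.range m, ∫ x in triangle (v i) (v (i + 1)), Real.exp (dot x z) := by
    intro z
    rw [hP, integral_biUnion_finset _ (fun i _ => measurableSet_openTriangle _ _) hdisj
      (fun i hi => (integrableOn_exp_dot hc z).mono_set
        ((subset_biUnion_of_mem (u := fun i => openTriangle (v i) (v (i + 1))) hi).trans hPK))]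
    refine Finset.sum_congr rfl fun i hi => ?_
    exact setIntegral_congr_set (openTriangle_ae_eq (hp i (Finset.mem_range.1 hi)))
  have hpos : ∀ x ∈ P, 0 < cross (v 0) x := by
    intro x hx
    obtain ⟨i, hi, hx⟩ := mem_iUnion₂.1 hx
    have hi := Finset.mem_range.1 hi
    have d := hp i hi
    rcases Nat.eq_zero_or_pos i with rfl | hi0
    · exact hx.2.1
    rw [eq_cross_combination (hp i hi).ne' x, cross_smul_add_right]
    have h1 := mul_pos (div_pos hx.1 d) (h.cross_pos 0 i hi0 hi)
    have h2 : 0 ≤ cross (v 0) (v (i + 1)) := by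
      rcases (show i + 1 ≤ m from hi).eq_or_lt with e | e
      · rw [e, h.close, cross_neg_right]; simp [cross, mul_comm]
      · exact (h.cross_pos 0 _ (by omega) e).le
    have h3 := mul_nonneg (div_pos hx.2.1 d).le h2
    linarith
  have hPP : Disjoint P (-P) := by
    rw [Set.disjoint_left]
    intro x hx hx'
    have h1 := hpos x hx
    have h2 := hpos (-x) hx'
    rw [cross_neg_right, cross_swap] at h2
    linarith
  have hInt := integrableOn_exp_dot hc y
  calc polygonExp m v y
      = (∫ x in P, Real.exp (dot x y)) + ∫ x in -P, Real.exp (dot x y) := by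
        rw [setIntegral_neg_exp, hsum, hsum, polygonExp, ← Finset.sum_add_distrib]
        exact Finset.sum_congr rfl fun i hi => coneTerm_eq_add (hp i (Finset.mem_range.1 hi)) y
    _ = ∫ x in P ∪ -P, Real.exp (dot x y) :=
        (setIntegral_union hPP hPm.neg (hInt.mono_set hPK) (hInt.mono_set hPK')).symm
    _ ≤ bodyExp K y := setIntegral_mono_set hInt (ae_of_all _ fun x => (Real.exp_pos _).le)
        (union_subset hPK hPK').eventuallyLE

/-- The exponential integral of a body is at most that of a covering family of triangles. -/
lemma bodyExp_le_polygonExp {m : ℕ} {v : ℕ → ℝ × ℝ} (hp : ∀ i < m, 0 < cross (v i) (v (i + 1)))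
    {K : Set (ℝ × ℝ)} (hc : IsCompact K)
    (hcov : ∀ x ∈ K, ∃ i < m, x ∈ triangle (v i) (v (i + 1)) ∨ -x ∈ triangle (v i) (v (i + 1)))
    (y : ℝ × ℝ) : bodyExp K y ≤ polygonExp m v y := by
  have hInt : ∀ i < m, ∀ z, IntegrableOn (fun x => Real.exp (dot x z))
      (triangle (v i) (v (i + 1))) := by
    intro i hi z
    by_contra hn
    have h1 := setIntegral_triangle (hp i hi) z
    rw [integral_undef hn] at h1
    exact (mul_pos (hp i hi) (triExp_pos _ _ _)).ne h1
  have hInt' : ∀ i < m, IntegrableOn (fun x => Real.exp (dot x y))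
      (-triangle (v i) (v (i + 1))) := by
    intro i hi
    by_contra hn
    have h1 := setIntegral_triangle (hp i hi) (-y)
    rw [← setIntegral_neg_exp, integral_undef hn] at h1
    exact (mul_pos (hp i hi) (triExp_pos _ _ _)).ne h1
  have hT := fun i => measurableSet_triangle (v i) (v (i + 1))
  let F : ℕ → ℝ × ℝ → ℝ := fun i x => (triangle (v i) (v (i + 1))).indicator
    (fun x => Real.exp (dot x y)) x + (-triangle (v i) (v (i + 1))).indicator
    (fun x => Real.exp (dot x y)) x
  have hF0 : ∀ i x, 0 ≤ F i x := fun i x => add_nonneg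
    (indicator_nonneg (fun _ _ => (Real.exp_pos _).le) _)
    (indicator_nonneg (fun _ _ => (Real.exp_pos _).le) _)
  have hFi : ∀ i ∈ Finset.range m, Integrable (F i) := fun i hi =>
    ((hInt i (Finset.mem_range.1 hi) y).integrable_indicator (hT i)).add
      ((hInt' i (Finset.mem_range.1 hi)).integrable_indicator (hT i).neg)
  have hFe : ∀ i ∈ Finset.range m, ∫ x, F i x = coneTerm (v i) (v (i + 1)) y := by
    intro i hi
    rw [Finset.mem_range] at hi
    rw [integral_add ((hInt i hi y).integrable_indicator (hT i))
      ((hInt' i hi).integrable_indicator (hT i).neg), integral_indicator (hT i),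
      integral_indicator (hT i).neg, setIntegral_neg_exp, coneTerm_eq_add (hp i hi)]
  rw [bodyExp, ← integral_indicator hc.measurableSet, polygonExp, ← Finset.sum_congr rfl hFe,
    ← integral_finsetSum _ hFi]
  refine integral_mono_of_nonneg (ae_of_all _ (indicator_nonneg fun _ _ => (Real.exp_pos _).le))
    (integrable_finsetSum _ hFi) (ae_of_all _ fun x => ?_)
  by_cases hx : x ∈ K
  · obtain ⟨i, hi, hxi⟩ := hcov x hx
    rw [indicator_of_mem hx]
    refine le_trans ?_ (Finset.single_le_sum (f := fun i => F i x) (fun i _ => hF0 i x)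
      (Finset.mem_range.2 hi))
    rcases hxi with hxi | hxi
    · simp only [F, indicator_of_mem hxi]
      exact le_add_of_nonneg_right (indicator_nonneg (fun _ _ => (Real.exp_pos _).le) _)
    · simp only [F, indicator_of_mem (show x ∈ -triangle (v i) (v (i + 1)) from hxi)]
      exact le_add_of_nonneg_left (indicator_nonneg (fun _ _ => (Real.exp_pos _).le) _)
  · rw [indicator_of_notMem hx]
    exact Finset.sum_nonneg fun i _ => hF0 i x

/-- Symmetric planar convex bodies. -/
structure SymBody (K : Set (ℝ × ℝ)) : Prop where
  isCompact : IsCompact K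
  convex : Convex ℝ K
  nhds_zero : K ∈ 𝓝 0
  symm : K = -K

namespace SymBody

variable {K : Set (ℝ × ℝ)}

lemma of_interior_nonempty (hc : IsCompact K) (hK : Convex ℝ K) (hi : (interior K).Nonempty)
    (hs : K = -K) : SymBody K := by
  refine ⟨hc, hK, ?_, hs⟩
  obtain ⟨x, hx⟩ := hi
  have hx' : -x ∈ interior K := by
    have := (Homeomorph.neg (ℝ × ℝ)).preimage_interior K
    have h2 : (Homeomorph.neg (ℝ × ℝ)) ⁻¹' K = K := by
      conv_rhs => rw [hs]
      rfl
    rw [h2] at this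
    rw [← this] at hx
    exact hx
  have := hK.interior hx hx' (a := 1 / 2) (b := 1 / 2) (by norm_num) (by norm_num) (by norm_num)
  rw [smul_neg, add_neg_cancel] at this
  exact mem_interior_iff_mem_nhds.1 this

lemma zero_mem (h : SymBody K) : (0 : ℝ × ℝ) ∈ K := mem_of_mem_nhds h.nhds_zero

lemma volume_pos (h : SymBody K) : 0 < (volume K).toReal :=
  ENNReal.toReal_pos (Measure.measure_pos_of_mem_nhds volume h.nhds_zero).ne' h.isCompact.measure_lt_top.ne

lemma continuous_bodyExp (h : SymBody K) : Continuous (bodyExp K) := by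
  refine continuous_parametric_integral_of_continuous (f := fun y x => Real.exp (dot x y)) ?_
    h.isCompact
  unfold dot Function.uncurry
  fun_prop

lemma growth (h : SymBody K) : ∃ κ c : ℝ, 0 < κ ∧ 0 < c ∧
    ∀ y : ℝ × ℝ, κ * Real.exp (c * (|y.1| + |y.2|)) ≤ bodyExp K y := by
  obtain ⟨r, hr, hrK⟩ := Metric.mem_nhds_iff.1 h.nhds_zero
  set d := r / 2 with hd
  have hd0 : 0 < d := by positivity
  have hu : ((d, 0) : ℝ × ℝ) ∈ K := hrK (by
    simp [Prod.norm_def, abs_of_pos hd0, hd0.le]; linarith)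
  have hv : ((0, d) : ℝ × ℝ) ∈ K := hrK (by
    simp [Prod.norm_def, abs_of_pos hd0, hd0.le]; linarith)
  have hcr : cross (d, 0) (0, d) = d ^ 2 := by simp [cross, sq]
  have hp : 0 < cross (d, 0) (0, d) := by rw [hcr]; positivity
  have hT := triangle_subset h.convex h.zero_mem hp hu hv
  refine ⟨d ^ 2 / 64, 3 / 16 * d, by positivity, by positivity, fun y => ?_⟩
  have hInt := integrableOn_exp_dot h.isCompact y
  have h1 : ∫ x in triangle (d, 0) (0, d), Real.exp (dot x y) ≤ bodyExp K y :=
    setIntegral_mono_set hInt (ae_of_all _ fun x => (Real.exp_pos _).le) hT.eventuallyLE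
  have h2 : ∫ x in triangle (d, 0) (0, d), Real.exp (dot x (-y)) ≤ bodyExp K y := by
    rw [← setIntegral_neg_exp]
    exact setIntegral_mono_set hInt (ae_of_all _ fun x => (Real.exp_pos _).le)
      (show -triangle (d, 0) (0, d) ⊆ K by
        rw [h.symm]; exact neg_subset_neg.2 hT).eventuallyLE
  have h3 := coneTerm_eq_add hp y
  have h4 := coneExp_growth (d * y.1) (d * y.2)
  rw [abs_mul, abs_mul, abs_of_pos hd0, ← mul_add, ← mul_assoc] at h4
  have h5 := mul_le_mul_of_nonneg_left h4 (sq_nonneg d)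
  have e1 : dot (d, 0) y = d * y.1 := by simp [dot]
  have e2 : dot (0, d) y = d * y.2 := by simp [dot]
  rw [coneTerm, hcr, e1, e2] at h3
  linarith

lemma bodyExp_pos (h : SymBody K) (y : ℝ × ℝ) : 0 < bodyExp K y := by
  obtain ⟨κ, c, hκ, -, hlow⟩ := h.growth
  exact pos_of_growth hκ hlow y

lemma integrable_rpow (h : SymBody K) {q : ℝ} (hq : 0 < q) :
    Integrable fun y => bodyExp K y ^ (-q) := by
  obtain ⟨κ, c, hκ, hc, hlow⟩ := h.growth
  exact integrable_rpow_of_growth hq h.continuous_bodyExp hκ hc hlow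

lemma bodyExp_zero (K : Set (ℝ × ℝ)) : bodyExp K 0 = (volume K).toReal := by
  simp [bodyExp, dot, Measure.real]

lemma mahlerVol_eq (h : SymBody K) {p : ℝ} (hp : 0 < p) :
    mahlerVol p K = (p ^ 2)⁻¹ * ((volume K).toReal ^ (1 + 1 / p) *
      ∫ y, bodyExp K y ^ (-(1 / p))) := by
  have hV := h.volume_pos
  have e : ∀ y, Real.exp (-(suppFn p K y)) =
      (volume K).toReal ^ (1 / p) * bodyExp K (p • y) ^ (-(1 / p)) := by
    intro y
    have e1 : ∫ x in K, Real.exp (p * (x.1 * y.1 + x.2 * y.2)) = bodyExp K (p • y) := by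
      simp only [bodyExp, dot, Prod.smul_fst, Prod.smul_snd, smul_eq_mul]
      congr 1; ext x; ring_nf
    have hB := h.bodyExp_pos (p • y)
    rw [suppFn, e1, Real.log_div hB.ne' hV.ne', Real.rpow_def_of_pos hV, Real.rpow_def_of_pos hB,
      ← Real.exp_add]
    ring_nf
  rw [mahlerVol]
  simp only [e]
  rw [integral_const_mul, Measure.integral_comp_smul volume (fun y => bodyExp K y ^ (-(1 / p)))]
  have hf : Module.finrank ℝ (ℝ × ℝ) = 2 := by simp
  rw [hf, abs_of_pos (by positivity), smul_eq_mul, Real.rpow_add hV, Real.rpow_one]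
  ring

/-- Points of the boundary, parametrized by their angle. -/
noncomputable def boundaryPoint (K : Set (ℝ × ℝ)) (θ : ℝ) : ℝ × ℝ :=
  (gauge K (Real.cos θ, Real.sin θ))⁻¹ • (Real.cos θ, Real.sin θ)

lemma absorbent (h : SymBody K) : Absorbent ℝ K := absorbent_nhds_zero h.nhds_zero

lemma gauge_circle_pos (h : SymBody K) (θ : ℝ) : 0 < gauge K (Real.cos θ, Real.sin θ) := by
  refine (gauge_pos h.absorbent
    ((NormedSpace.isVonNBounded_iff ℝ).2 h.isCompact.isBounded)).2 fun e => ?_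
  rw [Prod.mk_eq_zero] at e
  have := Real.cos_sq_add_sin_sq θ
  rw [e.1, e.2] at this
  norm_num at this

lemma gauge_boundaryPoint (h : SymBody K) (θ : ℝ) : gauge K (boundaryPoint K θ) = 1 := by
  rw [boundaryPoint, gauge_smul_of_nonneg (inv_nonneg.2 (h.gauge_circle_pos θ).le), smul_eq_mul,
    inv_mul_cancel₀ (h.gauge_circle_pos θ).ne']

lemma mem_of_gauge_le_one (h : SymBody K) {x : ℝ × ℝ} (hx : gauge K x ≤ 1) : x ∈ K := by
  have := (gauge_le_one_iff_mem_closure h.convex h.nhds_zero).1 hx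
  rwa [h.isCompact.isClosed.closure_eq] at this

lemma gauge_neg (h : SymBody K) (x : ℝ × ℝ) : gauge K (-x) = gauge K x :=
  _root_.gauge_neg (fun y hy => by rw [h.symm] at hy; exact hy) x

lemma continuous_boundaryPoint (h : SymBody K) : Continuous (boundaryPoint K) := by
  have hg := continuous_gauge h.convex h.nhds_zero
  have hc : Continuous fun θ : ℝ => (Real.cos θ, Real.sin θ) := by fun_prop
  exact ((hg.comp hc).inv₀ fun θ => (h.gauge_circle_pos θ).ne').smul hc

lemma cross_boundaryPoint_pos (h : SymBody K) {θ φ : ℝ} (h1 : θ < φ) (h2 : φ < θ + Real.pi) :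
    0 < cross (boundaryPoint K θ) (boundaryPoint K φ) := by
  have e : cross (boundaryPoint K θ) (boundaryPoint K φ) =
      (gauge K (Real.cos θ, Real.sin θ))⁻¹ * (gauge K (Real.cos φ, Real.sin φ))⁻¹ *
        Real.sin (φ - θ) := by
    simp only [cross, boundaryPoint, Prod.smul_fst, Prod.smul_snd, smul_eq_mul, Real.sin_sub]
    ring
  rw [e]
  exact mul_pos (mul_pos (inv_pos.2 (h.gauge_circle_pos _)) (inv_pos.2 (h.gauge_circle_pos _)))
    (Real.sin_pos_of_pos_of_lt_pi (by linarith) (by linarith))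

lemma boundaryPoint_pi (h : SymBody K) : boundaryPoint K Real.pi = -boundaryPoint K 0 := by
  have e : ((Real.cos Real.pi, Real.sin Real.pi) : ℝ × ℝ) = -(Real.cos 0, Real.sin 0) := by
    ext <;> simp
  rw [boundaryPoint, boundaryPoint, e, h.gauge_neg, smul_neg]

lemma turn_nonneg (h : SymBody K) {u v w : ℝ × ℝ} (huv : 0 < cross u v) (hvw : 0 < cross v w)
    (huw : 0 < cross u w) (hu : gauge K u = 1) (hv : gauge K v = 1) (hw : gauge K w = 1) :
    0 ≤ turn u v w := by
  have h1 := gauge_add_le h.convex h.absorbent ((cross v w / cross u w) • u)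
    ((cross u v / cross u w) • w)
  rw [← eq_cross_combination huw.ne' v, gauge_smul_of_nonneg (by positivity),
    gauge_smul_of_nonneg (by positivity), hu, hv, hw, smul_eq_mul, smul_eq_mul, mul_one, mul_one,
    ← add_div, le_div_iff₀ huw] at h1
  rw [turn]; linarith

/-- The vertices of the inscribed polygon with equally spaced angles. -/
noncomputable def vertex (K : Set (ℝ × ℝ)) (m i : ℕ) : ℝ × ℝ :=
  boundaryPoint K (i * (Real.pi / m))

lemma symPolygon_vertex (h : SymBody K) {m : ℕ} (hm : 3 ≤ m) : SymPolygon m (vertex K m) := by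
  have hm0 : (0 : ℝ) < m := by exact_mod_cast (by omega : 0 < m)
  have hclose : vertex K m m = -vertex K m 0 := by
    rw [vertex, vertex, mul_div_cancel₀ _ hm0.ne', h.boundaryPoint_pi, Nat.cast_zero, zero_mul]
  have hpos : ∀ i j, i < j → j < i + m → 0 < cross (vertex K m i) (vertex K m j) := by
    intro i j hij hj
    have hstep : 0 < Real.pi / m := div_pos Real.pi_pos hm0
    refine h.cross_boundaryPoint_pos ?_ ?_
    · have : (i : ℝ) < j := by exact_mod_cast hij
      gcongr
    · have : (j : ℝ) < i + m := by exact_mod_cast hj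
      have h2 := mul_lt_mul_of_pos_right this hstep
      rwa [add_mul, mul_div_cancel₀ _ hm0.ne'] at h2
  have hg : ∀ i, gauge K (vertex K m i) = 1 := fun i => h.gauge_boundaryPoint _
  refine ⟨hclose, fun i j hij hj => hpos i j hij (by omega), fun i hi => ?_, ?_⟩
  · exact h.turn_nonneg (hpos _ _ (by omega) (by omega)) (hpos _ _ (by omega) (by omega))
      (hpos _ _ (by omega) (by omega)) (hg _) (hg _) (hg _)
  · refine h.turn_nonneg ?_ ?_ ?_ (hg _) (by rw [h.gauge_neg, hg]) (by rw [h.gauge_neg, hg])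
    · rw [cross_neg_right]; exact hpos _ _ (by omega) (by omega)
    · have e : cross (-vertex K m 0) (-vertex K m 1) = cross (vertex K m 0) (vertex K m 1) := by
        simp only [cross, Prod.fst_neg, Prod.snd_neg]; ring
      rw [e]; exact hpos _ _ (by omega) (by omega)
    · rw [cross_neg_right]; exact hpos _ _ (by omega) (by omega)

lemma exists_gauge_vertex_sub_le (h : SymBody K) {ε : ℝ} (hε : 0 < ε) :
    ∃ n : ℕ, ∀ i < n + 3,
      gauge K (vertex K (n + 3) (i + 1) - vertex K (n + 3) i) ≤ ε := by
  have h0 := (continuous_gauge h.convex h.nhds_zero).continuousAt (x := (0 : ℝ × ℝ))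
  obtain ⟨r, hr, hr'⟩ := Metric.continuousAt_iff.1 h0 ε hε
  obtain ⟨δ, hδ, hδ'⟩ := Metric.uniformContinuousOn_iff.1
    ((isCompact_Icc (a := (0 : ℝ)) (b := Real.pi)).uniformContinuousOn_of_continuous
      h.continuous_boundaryPoint.continuousOn) r hr
  obtain ⟨n, hn⟩ := exists_nat_gt (Real.pi / δ)
  have hm0 : (0 : ℝ) < (n + 3 : ℕ) := by exact_mod_cast (by omega : 0 < n + 3)
  have hstep : 0 < Real.pi / (n + 3 : ℕ) := div_pos Real.pi_pos hm0
  have hstepδ : Real.pi / (n + 3 : ℕ) < δ := by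
    rw [div_lt_iff₀ hδ] at hn
    rw [div_lt_iff₀ hm0]
    push_cast
    nlinarith
  have hmem : ∀ i ≤ n + 3, (i : ℝ) * (Real.pi / (n + 3 : ℕ)) ∈ Icc (0 : ℝ) Real.pi := by
    intro i hi
    refine ⟨by positivity, ?_⟩
    have : (i : ℝ) ≤ (n + 3 : ℕ) := by exact_mod_cast hi
    calc (i : ℝ) * (Real.pi / (n + 3 : ℕ)) ≤ (n + 3 : ℕ) * (Real.pi / (n + 3 : ℕ)) := by gcongr
      _ = Real.pi := mul_div_cancel₀ _ hm0.ne'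
  refine ⟨n, fun i hi => ?_⟩
  have hd := hδ' _ (hmem (i + 1) hi) _ (hmem i hi.le) (by
    rw [Real.dist_eq, Nat.cast_succ, add_mul, add_sub_cancel_left, one_mul, abs_of_pos hstep]
    exact hstepδ)
  rw [dist_eq_norm] at hd
  have := hr' (x := vertex K (n + 3) (i + 1) - vertex K (n + 3) i) (by rwa [dist_zero_right])
  rw [gauge_zero, Real.dist_eq, sub_zero, abs_lt] at this
  exact this.2.le

/-- Slightly enlarged inscribed polygons cover the body. -/
lemma exists_mem_triangle (h : SymBody K) {ε : ℝ} (hε : 0 < ε) (hε1 : ε < 1) {n : ℕ}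
    (hn : ∀ i < n + 3, gauge K (vertex K (n + 3) (i + 1) - vertex K (n + 3) i) ≤ ε)
    {x : ℝ × ℝ} (hx : x ∈ K) (hx0 : 0 ≤ cross (vertex K (n + 3) 0) x) :
    ∃ i < n + 3, x ∈ triangle ((1 - ε)⁻¹ • vertex K (n + 3) i)
      ((1 - ε)⁻¹ • vertex K (n + 3) (i + 1)) := by
  set v := vertex K (n + 3)
  have hP : SymPolygon (n + 3) v := h.symPolygon_vertex (by omega)
  obtain ⟨i, hi, h1, h2⟩ : ∃ i < n + 3, 0 ≤ cross (v i) x ∧ cross (v (i + 1)) x ≤ 0 := by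
    by_contra! hcon
    have : ∀ i ≤ n + 3, 0 ≤ cross (v i) x := by
      intro i
      induction i with
      | zero => exact fun _ => hx0
      | succ i ih => exact fun hi => (hcon i hi (ih (by omega))).le
    have h3 := hcon (n + 2) (by omega) (this _ (by omega))
    rw [show n + 2 + 1 = n + 3 from rfl, hP.close, cross_swap, cross_neg_right] at h3
    linarith
  refine ⟨i, hi, ?_⟩
  have hD : 0 < cross (v i) (v (i + 1)) := hP.cross_pos' (by omega) hi (by omega)
  rw [cross_swap, neg_nonpos] at h2
  have hlam : 0 < 1 - ε := by linarith
  set s := cross x (v (i + 1)) / cross (v i) (v (i + 1)) with hs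
  set t := cross (v i) x / cross (v i) (v (i + 1)) with ht
  have hs0 : 0 ≤ s := by positivity
  have ht0 : 0 ≤ t := by positivity
  have hxe := eq_cross_combination hD.ne' x
  rw [← hs, ← ht] at hxe
  have key : (s + t) * (1 - ε) ≤ 1 := by
    have e : (s + t) • v i = x + t • -(v (i + 1) - v i) := by
      rw [hxe]; module
    have g1 := gauge_add_le h.convex h.absorbent x (t • -(v (i + 1) - v i))
    rw [← e, gauge_smul_of_nonneg (by positivity), gauge_smul_of_nonneg ht0, h.gauge_neg,
      smul_eq_mul, smul_eq_mul, show gauge K (v i) = 1 from h.gauge_boundaryPoint _] at g1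
    have g2 := gauge_le_one_of_mem hx
    have g3 := mul_le_mul_of_nonneg_left (hn i hi) ht0
    nlinarith
  have c1 : cross x ((1 - ε)⁻¹ • v (i + 1)) = (1 - ε)⁻¹ * cross x (v (i + 1)) := by
    simp only [cross, Prod.smul_fst, Prod.smul_snd, smul_eq_mul]; ring
  have c2 : cross ((1 - ε)⁻¹ • v i) x = (1 - ε)⁻¹ * cross (v i) x := by
    simp only [cross, Prod.smul_fst, Prod.smul_snd, smul_eq_mul]; ring
  have c3 : cross ((1 - ε)⁻¹ • v i) ((1 - ε)⁻¹ • v (i + 1)) =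
      (1 - ε)⁻¹ * (1 - ε)⁻¹ * cross (v i) (v (i + 1)) := by
    simp only [cross, Prod.smul_fst, Prod.smul_snd, smul_eq_mul]; ring
  refine ⟨?_, ?_, ?_⟩
  · rw [c1]; positivity
  · rw [c2]; positivity
  · rw [c1, c2, c3, ← mul_add, mul_assoc]
    refine mul_le_mul_of_nonneg_left ?_ (by positivity)
    rw [hs, ht, ← add_div, div_mul_eq_mul_div, div_le_one hD] at key
    rwa [inv_mul_eq_div, le_div_iff₀ hlam]

end SymBody

lemma cross_smul_smul (k : ℝ) (u v : ℝ × ℝ) : cross (k • u) (k • v) = k ^ 2 * cross u v := by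
  simp only [cross, Prod.smul_fst, Prod.smul_snd, smul_eq_mul]; ring

lemma turn_smul_smul (k : ℝ) (u v w : ℝ × ℝ) :
    turn (k • u) (k • v) (k • w) = k ^ 2 * turn u v w := by
  simp only [turn, cross_smul_smul]; ring

lemma SymPolygon.smul {m : ℕ} {v : ℕ → ℝ × ℝ} (h : SymPolygon m v) {k : ℝ} (hk : 0 < k) :
    SymPolygon m fun i => k • v i where
  close := by rw [h.close, smul_neg]
  cross_pos i j hij hj := by
    rw [cross_smul_smul]; exact mul_pos (by positivity) (h.cross_pos i j hij hj)
  convex i hi := by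
    rw [turn_smul_smul]; exact mul_nonneg (by positivity) (h.convex i hi)
  wrap := by
    rw [← smul_neg, ← smul_neg, turn_smul_smul]; exact mul_nonneg (by positivity) h.wrap

lemma polygonArea_smul (m : ℕ) (v : ℕ → ℝ × ℝ) (k : ℝ) :
    polygonArea m (fun i => k • v i) = k ^ 2 * polygonArea m v := by
  simp only [polygonArea, cross_smul_smul, Finset.mul_sum]

lemma coneExp_zero_zero : coneExp 0 0 = 1 := by
  have : triExp 0 0 0 = 1 / 2 := by
    rw [triExp, integral_stdTriangle (by fun_prop)]
    simp only [sub_self, mul_zero, add_zero, Real.exp_zero, intervalIntegral.integral_const,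
      smul_eq_mul, mul_one, sub_zero]
    rw [intervalIntegral.integral_sub (by simp) (by simp)]
    norm_num [integral_id]
  rw [coneExp, neg_zero, this]; norm_num

lemma polygonExp_zero (m : ℕ) (v : ℕ → ℝ × ℝ) : polygonExp m v 0 = polygonArea m v := by
  have : ∀ u : ℝ × ℝ, dot u 0 = 0 := fun u => by simp [dot]
  simp only [polygonExp, polygonArea, coneTerm, this, coneExp_zero_zero, mul_one]

/-- Parallelograms minimize the functional among symmetric convex bodies. -/
theorem SymBody.parallelogramValue_le {K : Set (ℝ × ℝ)} (h : SymBody K) {q : ℝ} (hq : 0 < q) :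
    parallelogramValue q ≤ (volume K).toReal ^ (1 + q) * ∫ y, bodyExp K y ^ (-q) := by
  have key : ∀ ε : ℝ, 0 < ε → ε < 1 → parallelogramValue q ≤
      (((1 - ε)⁻¹) ^ 2 * (volume K).toReal) ^ (1 + q) * ∫ y, bodyExp K y ^ (-q) := by
    intro ε hε hε1
    obtain ⟨n, hn⟩ := h.exists_gauge_vertex_sub_le hε
    have hlam : 0 < (1 - ε)⁻¹ := inv_pos.2 (by linarith)
    set v := vertex K (n + 3) with hv
    have hP : SymPolygon (n + 3) v := h.symPolygon_vertex (by omega)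
    have hP' := hP.smul hlam
    refine (hP'.parallelogramValue_le hq).trans ?_
    have hA : polygonArea (n + 3) v ≤ (volume K).toReal := by
      rw [← polygonExp_zero, ← bodyExp_zero]
      exact hP.polygonExp_le_bodyExp (by omega) h.isCompact h.convex h.symm h.zero_mem
        (fun i => h.mem_of_gauge_le_one (h.gauge_boundaryPoint _).le) 0
    have hcov : ∀ x ∈ K, ∃ i < n + 3,
        x ∈ triangle ((1 - ε)⁻¹ • v i) ((1 - ε)⁻¹ • v (i + 1)) ∨
        -x ∈ triangle ((1 - ε)⁻¹ • v i) ((1 - ε)⁻¹ • v (i + 1)) := by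
      intro x hx
      rcases le_total 0 (cross (v 0) x) with h0 | h0
      · obtain ⟨i, hi, hxi⟩ := h.exists_mem_triangle hε hε1 hn hx h0
        exact ⟨i, hi, Or.inl hxi⟩
      · have hx' : -x ∈ K := by rw [h.symm] at hx; exact hx
        obtain ⟨i, hi, hxi⟩ := h.exists_mem_triangle hε hε1 hn hx' (by
          rw [cross_neg_right, cross_swap]; linarith)
        exact ⟨i, hi, Or.inr hxi⟩
    have hE := bodyExp_le_polygonExp (v := fun i => (1 - ε)⁻¹ • v i)
      (fun i hi => hP'.cross_pos' (Nat.lt_succ_self i) hi (by omega)) h.isCompact hcov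
    have hA0 := hP.area_nonneg (by omega)
    have hI0 : ∀ y, 0 ≤ polygonExp (n + 3) (fun i => (1 - ε)⁻¹ • v i) y := fun y =>
      (h.bodyExp_pos y).le.trans (hE y)
    rw [polygonArea_smul]
    refine mul_le_mul (Real.rpow_le_rpow (by positivity) ?_ (by positivity)) ?_
      (integral_nonneg fun y => Real.rpow_nonneg (hI0 y) _) (Real.rpow_nonneg (by positivity) _)
    · gcongr
    · refine integral_mono_of_nonneg (ae_of_all _ fun y => Real.rpow_nonneg (hI0 y) _)
        (h.integrable_rpow hq) (ae_of_all _ fun y => ?_)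
      exact Real.rpow_le_rpow_of_nonpos (h.bodyExp_pos y) (hE y) (by linarith)
  have hlim : Tendsto (fun ε : ℝ => (((1 - ε)⁻¹) ^ 2 * (volume K).toReal) ^ (1 + q) *
      ∫ y, bodyExp K y ^ (-q)) (𝓝[>] 0)
      (𝓝 ((volume K).toReal ^ (1 + q) * ∫ y, bodyExp K y ^ (-q))) := by
    have hc : ContinuousAt (fun ε : ℝ => (((1 - ε)⁻¹) ^ 2 * (volume K).toReal) ^ (1 + q) *
        ∫ y, bodyExp K y ^ (-q)) 0 := by
      refine ContinuousAt.mul (ContinuousAt.rpow_const ?_ (Or.inr (by linarith))) continuousAt_const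
      refine ((ContinuousAt.inv₀ (by fun_prop) (by norm_num)).pow 2).mul continuousAt_const
    have := hc.tendsto
    simp only [sub_zero, inv_one, one_pow, one_mul] at this
    exact this.mono_left nhdsWithin_le_nhds
  refine ge_of_tendsto hlim ?_
  filter_upwards [Ioo_mem_nhdsGT (zero_lt_one' ℝ)] with ε hε
  exact key ε hε.1 hε.2

lemma symBody_square : SymBody (Icc ((-1 : ℝ), (-1 : ℝ)) (1, 1)) := by
  refine ⟨isCompact_Icc, convex_Icc _ _, ?_, ?_⟩
  · refine Icc_prod_eq (α := ℝ) (β := ℝ) (-1, -1) (1, 1) ▸ ?_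
    exact prod_mem_nhds (Icc_mem_nhds (by norm_num) (by norm_num))
      (Icc_mem_nhds (by norm_num) (by norm_num))
  · rw [neg_Icc]; simp

lemma square_le_parallelogramValue {q : ℝ} (hq : 0 < q) :
    (volume (Icc ((-1 : ℝ), (-1 : ℝ)) (1, 1))).toReal ^ (1 + q) *
      ∫ y, bodyExp (Icc ((-1 : ℝ), (-1 : ℝ)) (1, 1)) y ^ (-q) ≤ parallelogramValue q := by
  have hV : (volume (Icc ((-1 : ℝ), (-1 : ℝ)) (1, 1))).toReal = 4 := by
    rw [← Icc_prod_Icc, Measure.volume_eq_prod, Measure.prod_prod, Real.volume_Icc]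
    norm_num
  have hcr : cross (1, -1) (1, 1) = 2 := by norm_num [cross]
  have hp : 0 < cross (1, -1) (1, 1) := by rw [hcr]; norm_num
  let v : ℕ → ℝ × ℝ
    | 0 => (1, -1)
    | 1 => (1, 1)
    | _ => -(1, -1)
  have hP : SymPolygon 2 v := by
    refine ⟨rfl, ?_, ?_, ?_⟩
    · intro i j hij hj
      obtain ⟨rfl, rfl⟩ : i = 0 ∧ j = 1 := by omega
      exact hp
    · intro i hi
      obtain rfl : i = 0 := by omega
      simp only [v, turn, cross, Prod.fst_neg, Prod.snd_neg]; norm_num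
    · simp only [v, turn, cross, Prod.fst_neg, Prod.snd_neg]; norm_num
  have hS := symBody_square
  have hle : ∀ y, coneTerm (1, -1) (1, 1) y + coneTerm (1, 1) (-(1, -1)) y ≤
      bodyExp (Icc ((-1 : ℝ), (-1 : ℝ)) (1, 1)) y := by
    intro y
    have := hP.polygonExp_le_bodyExp le_rfl hS.isCompact hS.convex hS.symm hS.zero_mem ?_ y
    · simpa [polygonExp, Finset.sum_range_succ, v] using this
    · intro i
      match i with
      | 0 => simp only [v, mem_Icc, Prod.mk_le_mk]; norm_num
      | 1 => simp only [v, mem_Icc, Prod.mk_le_mk]; norm_num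
      | i + 2 => simp only [v, mem_Icc, Prod.neg_mk, Prod.mk_le_mk]; norm_num
  have hpos : 0 < cross (1, 1) (-(1, -1)) := by norm_num [cross]
  have hlow : ∀ y : ℝ × ℝ, 1 / 16 * Real.exp (3 / 16 * (|y.1| + |y.2|)) ≤
      coneTerm (1, -1) (1, 1) y + coneTerm (1, 1) (-(1, -1)) y := by
    intro y
    have h0 := (evenLogConvex_coneTerm hpos.le).nonneg y
    have h1 := coneExp_growth (dot (1, -1) y) (dot (1, 1) y)
    have h2 : |y.1| + |y.2| ≤ |dot (1, -1) y| + |dot (1, 1) y| := by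
      simp only [dot, one_mul, neg_mul]
      have a1 := abs_add_le (y.1 + -y.2) (y.1 + y.2)
      have a2 := abs_sub (y.1 + y.2) (y.1 + -y.2)
      rw [show y.1 + -y.2 + (y.1 + y.2) = 2 * y.1 by ring, abs_mul, abs_two] at a1
      rw [show y.1 + y.2 - (y.1 + -y.2) = 2 * y.2 by ring, abs_mul, abs_two] at a2
      linarith
    have h3 : Real.exp (3 / 16 * (|y.1| + |y.2|)) ≤
        Real.exp (3 / 16 * (|dot (1, -1) y| + |dot (1, 1) y|)) := by gcongr
    have h4 : coneTerm (1, -1) (1, 1) y = 2 * coneExp (dot (1, -1) y) (dot (1, 1) y) := by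
      rw [coneTerm, hcr]
    linarith
  rw [← parallelogram_eq q hp, hcr, hV, show (2 * 2 : ℝ) = 4 by norm_num]
  refine mul_le_mul_of_nonneg_left ?_ (by positivity)
  refine integral_mono_of_nonneg
    (ae_of_all _ fun y => Real.rpow_nonneg (hS.bodyExp_pos y).le _)
    (integrable_rpow_of_growth hq ((evenLogConvex_coneTerm hp.le).add
      (evenLogConvex_coneTerm hpos.le)).continuous (by norm_num) (by norm_num) hlow)
    (ae_of_all _ fun y => ?_)
  exact Real.rpow_le_rpow_of_nonpos (pos_of_growth (by norm_num) hlow y) (hle y) (by linarith)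

end LpMahler

/-- Conjecture `pMahlerSym` in dimension 2, Theorem 1.8:
for `p ∈ (0,∞)` and every symmetric convex body `K ⊆ ℝ²`,
`M_p([-1,1]²) ≤ M_p(K)`. -/
theorem lp_mahler_symmetric_two_dim (p : ℝ) (hp : 0 < p)
    (K : Set (ℝ × ℝ)) (hKcomp : IsCompact K) (hKconv : Convex ℝ K)
    (hKint : (interior K).Nonempty) (hKsym : K = -K) :
    mahlerVol p (Set.Icc ((-1 : ℝ), (-1 : ℝ)) (1, 1)) ≤ mahlerVol p K := by
  have h := LpMahler.SymBody.of_interior_nonempty hKcomp hKconv hKint hKsym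
  have hq : 0 < 1 / p := by positivity
  rw [LpMahler.symBody_square.mahlerVol_eq hp, h.mahlerVol_eq hp]
  exact mul_le_mul_of_nonneg_left ((LpMahler.square_le_parallelogramValue hq).trans
    (h.parallelogramValue_le hq)) (by positivity)
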